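/- arXiv:math/0309024 — 2 statements merged into one kernel-verified Lean document; each statement's English description precedes it below -/
import Mathlib

section
/- Let ω^b be a bounded smooth open set in ℝ² with 0 ∈ ω^b, set Ω^b = ω^b×(−1,0), and let v ∈ L²(ω^b;H¹(−1,0)). Then there exist a sequence of positive numbers r^n tending to zero and a sequence of functions v^n ∈ C¹(Ω̄^b) such that v^n ≡ 0 on B^n × {0}, where B^n is the ball of center 0 and radius r^n, and v^n → v strongly in L²(ω^b;H¹(−1,0)). -/
open MeasureTheory Filter Topology Set
open scoped BigOperators MeasureTheory

noncomputable section

abbrev R2 : Type := ℝ × ℝ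
abbrev R3 : Type := (ℝ × ℝ) × ℝ

/-- the standard basis of `R3`. -/
def b3 : Fin 3 → R3 := fun i =>
  if i = 0 then ((1, 0), 0) else if i = 1 then ((0, 1), 0) else ((0, 0), 1)

/-- the standard basis of `R2`. -/
def b2 : Fin 2 → R2 := fun i => if i = 0 then (1, 0) else (0, 1)

/-- `i`-th partial derivative of a function on `R3`. -/
def pd (i : Fin 3) (φ : R3 → ℝ) (x : R3) : ℝ := fderiv ℝ φ x (b3 i)

/-- `i`-th partial derivative of a function on `R2`. -/
def pd2 (i : Fin 2) (φ : R2 → ℝ) (x : R2) : ℝ := fderiv ℝ φ x (b2 i)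

def IsTest3 (Ω : Set R3) (φ : R3 → ℝ) : Prop :=
  ContDiff ℝ (⊤ : ℕ∞) φ ∧ HasCompactSupport φ ∧ tsupport φ ⊆ Ω

def IsTest2 (Ω : Set R2) (φ : R2 → ℝ) : Prop :=
  ContDiff ℝ (⊤ : ℕ∞) φ ∧ HasCompactSupport φ ∧ tsupport φ ⊆ Ω

def IsTest1 (I : Set ℝ) (φ : ℝ → ℝ) : Prop :=
  ContDiff ℝ (⊤ : ℕ∞) φ ∧ HasCompactSupport φ ∧ tsupport φ ⊆ I

/-- `g` is the `i`-th weak partial derivative of `u` on `Ω ⊆ R3`. -/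
def HasWPD (Ω : Set R3) (u : R3 → ℝ) (i : Fin 3) (g : R3 → ℝ) : Prop :=
  ∀ φ : R3 → ℝ, IsTest3 Ω φ →
    ∫ x in Ω, u x * pd i φ x = - ∫ x in Ω, g x * φ x

def HasWPD2 (Ω : Set R2) (u : R2 → ℝ) (i : Fin 2) (g : R2 → ℝ) : Prop :=
  ∀ φ : R2 → ℝ, IsTest2 Ω φ →
    ∫ x in Ω, u x * pd2 i φ x = - ∫ x in Ω, g x * φ x

def HasWD1 (I : Set ℝ) (u g : ℝ → ℝ) : Prop :=
  ∀ φ : ℝ → ℝ, IsTest1 I φ →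
    ∫ t in I, u t * deriv φ t = - ∫ t in I, g t * φ t

/-- membership in `L²(μ)`. -/
def MemL2 {X : Type*} [MeasurableSpace X] (μ : Measure X) (f : X → ℝ) : Prop :=
  MemLp f 2 μ

/-- `H¹(Ω)` for `Ω ⊆ R3`. -/
def MemH1 (Ω : Set R3) (u : R3 → ℝ) : Prop :=
  MemL2 (volume.restrict Ω) u ∧
    ∀ i : Fin 3, ∃ g, MemL2 (volume.restrict Ω) g ∧ HasWPD Ω u i g

/-- `H¹(Ω)` for `Ω ⊆ R2`. -/
def MemH1_2 (Ω : Set R2) (u : R2 → ℝ) : Prop :=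
  MemL2 (volume.restrict Ω) u ∧
    ∀ i : Fin 2, ∃ g, MemL2 (volume.restrict Ω) g ∧ HasWPD2 Ω u i g

/-- `H¹(I)` for an interval `I ⊆ ℝ`. -/
def MemH1_1 (I : Set ℝ) (u : ℝ → ℝ) : Prop :=
  MemL2 (volume.restrict I) u ∧ ∃ g, MemL2 (volume.restrict I) g ∧ HasWD1 I u g

/-- extension by zero outside `ω`. -/
def zext2 (ω : Set R2) (u : R2 → ℝ) : R2 → ℝ := ω.indicator u

/-- `H¹₀(ω)` for `ω ⊆ ℝ²`, characterized via extension by zero. -/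
def MemH10_2 (ω : Set R2) (u : R2 → ℝ) : Prop := MemH1_2 univ (zext2 ω u)

/-- `H²₀(ω)` for `ω ⊆ ℝ²`, characterized via extension by zero. -/
def MemH20_2 (ω : Set R2) (u : R2 → ℝ) : Prop :=
  MemH1_2 univ (zext2 ω u) ∧
    ∀ i : Fin 2, ∃ g, HasWPD2 univ (zext2 ω u) i g ∧ MemH1_2 univ g

/-- `H¹(0,1)` functions vanishing at `1` (with continuous representative). -/
def MemH1T (u : ℝ → ℝ) : Prop :=
  MemH1_1 (Ioo 0 1) u ∧ ContinuousOn u (Icc 0 1) ∧ u 1 = 0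

/-- `H¹₀(0,1)` (with continuous representative). -/
def MemH10_1 (u : ℝ → ℝ) : Prop :=
  MemH1_1 (Ioo 0 1) u ∧ ContinuousOn u (Icc 0 1) ∧ u 0 = 0 ∧ u 1 = 0

/-- `H²₀(0,1)`. -/
def MemH20_1 (u : ℝ → ℝ) : Prop :=
  MemH10_1 u ∧ ∃ g, HasWD1 (Ioo 0 1) u g ∧ MemH10_1 g

/-- the beam `Ωᵃ = ωᵃ × (0,1)`. -/
def OmA (ωa : Set R2) : Set R3 := ωa ×ˢ Ioo (0:ℝ) 1

/-- the plate `Ωᵇ = ωᵇ × (−1,0)`. -/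
def OmB (ωb : Set R2) : Set R3 := ωb ×ˢ Ioo (-1:ℝ) 0

/-- zero trace on the top face `ωᵃ × {1}`: the extension by zero above `x₃ = 1` is `H¹`. -/
def ZeroTopA (ωa : Set R2) (u : R3 → ℝ) : Prop :=
  MemH1 (ωa ×ˢ Ioo (0:ℝ) 2) (Set.indicator ((univ : Set R2) ×ˢ Iio (1:ℝ)) u)

/-- zero trace on the lateral boundary `Σᵇ = ∂ωᵇ × (−1,0)`:
the extension by zero in `x'` is `H¹`. -/
def ZeroLatB (ωb : Set R2) (u : R3 → ℝ) : Prop :=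
  MemH1 ((univ : Set R2) ×ˢ Ioo (-1:ℝ) 0) (Set.indicator (ωb ×ˢ (univ : Set ℝ)) u)

/-- scaling factors of the rescaled beam strain `e^{aε}`. -/
def sA (r : ℝ) (i j : Fin 3) : ℝ :=
  if i = 2 ∧ j = 2 then 1 else if i ≠ 2 ∧ j ≠ 2 then 1 / r ^ 2 else 1 / r

/-- scaling factors of the rescaled plate strain `e^{bε}`. -/
def sB (e : ℝ) (i j : Fin 3) : ℝ :=
  if i = 2 ∧ j = 2 then 1 / e ^ 2 else if i ≠ 2 ∧ j ≠ 2 then 1 else 1 / e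

/-- `E i j = s i j • e_{ij}(u)` in the weak sense on `Ω`. -/
def IsScaledStrain (Ω : Set R3) (s : Fin 3 → Fin 3 → ℝ) (u : Fin 3 → R3 → ℝ)
    (E : Fin 3 → Fin 3 → R3 → ℝ) : Prop :=
  ∀ i j : Fin 3, ∀ φ : R3 → ℝ, IsTest3 Ω φ →
    s i j * ∫ x in Ω, (u i x * pd j φ x + u j x * pd i φ x)
      = -2 * ∫ x in Ω, E i j x * φ x

/-- `e = e_{ij}` of the pair of component functions `(f, g)` in directions `(i, j)`. -/
def IsStrainEntry (Ω : Set R3) (f g : R3 → ℝ) (i j : Fin 3) (e : R3 → ℝ) : Prop :=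
  ∀ φ : R3 → ℝ, IsTest3 Ω φ →
    ∫ x in Ω, (f x * pd j φ x + g x * pd i φ x) = -2 * ∫ x in Ω, e x * φ x

/-- which field contributes the `(i,j)` entry of the limit beam strain. -/
def fieldSel (u v w : Fin 3 → R3 → ℝ) (i j : Fin 3) : Fin 3 → R3 → ℝ :=
  if i = 2 ∧ j = 2 then u else if i ≠ 2 ∧ j ≠ 2 then w else v

/-- `E = eᵃ(zᵃ)`: entries `e_{αβ}(wᵃ)`, `e_{α3}(vᵃ)`, `e_{33}(uᵃ)`. -/
def IsLimStrainA (Ω : Set R3) (u v w : Fin 3 → R3 → ℝ)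
    (E : Fin 3 → Fin 3 → R3 → ℝ) : Prop :=
  ∀ i j, IsStrainEntry Ω (fieldSel u v w i j i) (fieldSel u v w i j j) i j (E i j)

/-- `E = eᵇ(zᵇ)`: entries `e_{αβ}(uᵇ)`, `e_{α3}(vᵇ)`, `e_{33}(wᵇ)`. -/
def IsLimStrainB (Ω : Set R3) (u v w : Fin 3 → R3 → ℝ)
    (E : Fin 3 → Fin 3 → R3 → ℝ) : Prop :=
  ∀ i j, IsStrainEntry Ω (fieldSel w v u i j i) (fieldSel w v u i j j) i j (E i j)

/-- weak convergence in `L²(μ)`. -/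
def WeakL2 {X : Type*} [MeasurableSpace X] (μ : Measure X) (F : ℕ → X → ℝ) (f : X → ℝ) : Prop :=
  ∀ g : X → ℝ, MemL2 μ g →
    Tendsto (fun n => ∫ x, F n x * g x ∂μ) atTop (𝓝 (∫ x, f x * g x ∂μ))

/-- strong convergence in `L²(μ)`. -/
def StrongL2 {X : Type*} [MeasurableSpace X] (μ : Measure X) (F : ℕ → X → ℝ) (f : X → ℝ) : Prop :=
  Tendsto (fun n => ∫ x, (F n x - f x) ^ 2 ∂μ) atTop (𝓝 0)

/-- weak convergence in `H¹(Ω)`, `Ω ⊆ R3`. -/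
def WeakH1 (Ω : Set R3) (F : ℕ → R3 → ℝ) (f : R3 → ℝ) : Prop :=
  WeakL2 (volume.restrict Ω) F f ∧
    ∀ i : Fin 3, ∀ (G : ℕ → R3 → ℝ) (g : R3 → ℝ),
      (∀ n, HasWPD Ω (F n) i (G n)) → HasWPD Ω f i g → WeakL2 (volume.restrict Ω) G g

/-- strong convergence in `H¹(Ω)`, `Ω ⊆ R3`. -/
def StrongH1 (Ω : Set R3) (F : ℕ → R3 → ℝ) (f : R3 → ℝ) : Prop :=
  StrongL2 (volume.restrict Ω) F f ∧
    ∀ i : Fin 3, ∀ (G : ℕ → R3 → ℝ) (g : R3 → ℝ),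
      (∀ n, HasWPD Ω (F n) i (G n)) → HasWPD Ω f i g → StrongL2 (volume.restrict Ω) G g

/-- `L²(0,1;H¹(ωᵃ))` realized on `Ωᵃ`: `L²` with horizontal weak derivatives in `L²`. -/
def MemL2H1h (Ω : Set R3) (v : R3 → ℝ) : Prop :=
  MemL2 (volume.restrict Ω) v ∧
    ∀ i : Fin 3, i ≠ 2 → ∃ g, MemL2 (volume.restrict Ω) g ∧ HasWPD Ω v i g

/-- `L²(ωᵇ;H¹(−1,0))` realized on `Ωᵇ`: `L²` with vertical weak derivative in `L²`. -/
def MemL2H1v (Ω : Set R3) (v : R3 → ℝ) : Prop :=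
  MemL2 (volume.restrict Ω) v ∧
    ∃ g, MemL2 (volume.restrict Ω) g ∧ HasWPD Ω v 2 g

/-- weak convergence in `L²(0,1;H¹(ωᵃ))` (functions and horizontal weak derivatives). -/
def WeakL2H1h (Ω : Set R3) (F : ℕ → R3 → ℝ) (f : R3 → ℝ) : Prop :=
  WeakL2 (volume.restrict Ω) F f ∧
    ∀ i : Fin 3, i ≠ 2 → ∀ (G : ℕ → R3 → ℝ) (g : R3 → ℝ),
      (∀ n, HasWPD Ω (F n) i (G n)) → HasWPD Ω f i g → WeakL2 (volume.restrict Ω) G g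

/-- weak convergence in `L²(ωᵇ;H¹(−1,0))` (functions and vertical weak derivatives). -/
def WeakL2H1v (Ω : Set R3) (F : ℕ → R3 → ℝ) (f : R3 → ℝ) : Prop :=
  WeakL2 (volume.restrict Ω) F f ∧
    ∀ (G : ℕ → R3 → ℝ) (g : R3 → ℝ),
      (∀ n, HasWPD Ω (F n) 2 (G n)) → HasWPD Ω f 2 g → WeakL2 (volume.restrict Ω) G g

/-- the space `𝒰ᵃ` (Bernoulli–Navier displacements, clamped at the top). -/
def MemUa (ωa : Set R2) (u : Fin 3 → R3 → ℝ) : Prop :=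
  ∃ U U' : Fin 2 → ℝ → ℝ, ∃ ζ : ℝ → ℝ,
    (∀ α, MemH20_1 (U α)) ∧ (∀ α, HasWD1 (Ioo 0 1) (U α) (U' α)) ∧ MemH1T ζ ∧
    u 0 = (fun x => U 0 x.2) ∧ u 1 = (fun x => U 1 x.2) ∧
    u 2 = (fun x => ζ x.2 - x.1.1 * U' 0 x.2 - x.1.2 * U' 1 x.2) ∧
    MemH1 (OmA ωa) (u 2)

/-- the space `𝒱ᵃ`. -/
def MemVa (ωa : Set R2) (v : Fin 3 → R3 → ℝ) : Prop :=
  ∃ c : ℝ → ℝ, MemH10_1 c ∧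
    v 0 = (fun x => - c x.2 * x.1.2) ∧ v 1 = (fun x => c x.2 * x.1.1) ∧
    MemH1 (OmA ωa) (v 0) ∧ MemH1 (OmA ωa) (v 1) ∧
    MemL2H1h (OmA ωa) (v 2) ∧
    (∀ᵐ t ∂(volume.restrict (Ioo (0:ℝ) 1)), (∫ y in ωa, v 2 (y, t)) = 0)

/-- the space `𝒲ᵃ`. -/
def MemWa (ωa : Set R2) (w : Fin 3 → R3 → ℝ) : Prop :=
  w 2 = (fun _ => (0:ℝ)) ∧ MemL2H1h (OmA ωa) (w 0) ∧ MemL2H1h (OmA ωa) (w 1) ∧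
  (∀ᵐ t ∂(volume.restrict (Ioo (0:ℝ) 1)),
    (∫ y in ωa, w 0 (y, t)) = 0 ∧ (∫ y in ωa, w 1 (y, t)) = 0 ∧
    (∫ y in ωa, (y.1 * w 1 (y, t) - y.2 * w 0 (y, t))) = 0)

/-- the space `𝒰ᵇ` (Kirchhoff–Love displacements, clamped on the lateral boundary). -/
def MemUb (ωb : Set R2) (u : Fin 3 → R3 → ℝ) : Prop :=
  ∃ U3 : R2 → ℝ, ∃ D ζ : Fin 2 → R2 → ℝ,
    MemH20_2 ωb U3 ∧ (∀ α, HasWPD2 ωb U3 α (D α)) ∧ (∀ α, MemH10_2 ωb (ζ α)) ∧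
    u 0 = (fun x => ζ 0 x.1 - x.2 * D 0 x.1) ∧
    u 1 = (fun x => ζ 1 x.1 - x.2 * D 1 x.1) ∧
    u 2 = (fun x => U3 x.1) ∧
    MemH1 (OmB ωb) (u 0) ∧ MemH1 (OmB ωb) (u 1)

/-- the space `𝒱ᵇ`. -/
def MemVb (ωb : Set R2) (v : Fin 3 → R3 → ℝ) : Prop :=
  v 2 = (fun _ => (0:ℝ)) ∧ MemL2H1v (OmB ωb) (v 0) ∧ MemL2H1v (OmB ωb) (v 1) ∧
  (∀ᵐ y ∂(volume.restrict ωb),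
    (∫ t in Ioo (-1:ℝ) 0, v 0 (y, t)) = 0 ∧ (∫ t in Ioo (-1:ℝ) 0, v 1 (y, t)) = 0)

/-- the space `𝒲ᵇ`. -/
def MemWb (ωb : Set R2) (w : Fin 3 → R3 → ℝ) : Prop :=
  w 0 = (fun _ => (0:ℝ)) ∧ w 1 = (fun _ => (0:ℝ)) ∧ MemL2H1v (OmB ωb) (w 2) ∧
  (∀ᵐ y ∂(volume.restrict ωb), (∫ t in Ioo (-1:ℝ) 0, w 2 (y, t)) = 0)

def MemZa (ωa : Set R2) (u v w : Fin 3 → R3 → ℝ) : Prop :=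
  MemUa ωa u ∧ MemVa ωa v ∧ MemWa ωa w

def MemZb (ωb : Set R2) (u v w : Fin 3 → R3 → ℝ) : Prop :=
  MemUb ωb u ∧ MemVb ωb v ∧ MemWb ωb w

/-- the junction condition `uᵃ₃(x',0) = uᵇ₃(0)` of the space `𝒵`. -/
def JunctionZ (ωa : Set R2) (uA uB : Fin 3 → R3 → ℝ) : Prop :=
  ∀ᵐ y ∂(volume.restrict ωa), uA 2 (y, 0) = uB 2 (((0:ℝ), (0:ℝ)), 0)

/-- symmetry of a fourth order elasticity tensor. -/
def TensorSymm (A : Fin 3 → Fin 3 → Fin 3 → Fin 3 → ℝ) : Prop :=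
  ∀ i j k l, A i j k l = A j i k l ∧ A i j k l = A i j l k

/-- `[Aξ, η]`, the Frobenius pairing of `Aξ` with `η`. -/
def tApp (A : Fin 3 → Fin 3 → Fin 3 → Fin 3 → ℝ) (ξ η : Fin 3 → Fin 3 → ℝ) : ℝ :=
  ∑ i, ∑ j, ∑ k, ∑ l, A i j k l * ξ k l * η i j

/-- coercivity of a fourth order elasticity tensor on symmetric matrices. -/
def TensorCoercive (A : Fin 3 → Fin 3 → Fin 3 → Fin 3 → ℝ) : Prop :=
  ∃ C > (0:ℝ), ∀ ξ : Fin 3 → Fin 3 → ℝ, (∀ i j, ξ i j = ξ j i) →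
    C * (∑ i, ∑ j, (ξ i j) ^ 2) ≤ tApp A ξ ξ

/-- Frobenius inner product. -/
def frob (ξ η : Fin 3 → Fin 3 → ℝ) : ℝ := ∑ i, ∑ j, ξ i j * η i j

/-- dilation of the plane. -/
def rsc (r : ℝ) (y : R2) : R2 := (r * y.1, r * y.2)

/-- the surface measure on `Σᵃ = ∂ωᵃ × (0,1)`:
one-dimensional Hausdorff measure on `∂ωᵃ` times Lebesgue measure. -/
def sigA (ωa : Set R2) : Measure R3 :=
  ((μH[1] : Measure R2).restrict (frontier ωa)).prod (volume.restrict (Ioo (0:ℝ) 1))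

/-- membership in the rescaled space `𝒴^ε`, including the junction conditions. -/
def MemY (ωa ωb : Set R2) (ep r : ℝ) (ua ub : Fin 3 → R3 → ℝ) : Prop :=
  (∀ k, MemH1 (OmA ωa) (ua k)) ∧ (∀ k, MemH1 (OmB ωb) (ub k)) ∧
  (∀ k, ZeroTopA ωa (ua k)) ∧ (∀ k, ZeroLatB ωb (ub k)) ∧
  (∀ᵐ y ∂(volume.restrict ωa),
    ua 0 (y, 0) = ep * r * ub 0 (rsc r y, 0) ∧
    ua 1 (y, 0) = ep * r * ub 1 (rsc r y, 0) ∧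
    ua 2 (y, 0) = ub 2 (rsc r y, 0))

/-- the bilinear form of the (rescaled or limit) problem. -/
def LHS (ωa ωb : Set R2) (Aa Ab : Fin 3 → Fin 3 → Fin 3 → Fin 3 → ℝ) (q : ℝ)
    (Ea Eb Fa Fb : Fin 3 → Fin 3 → R3 → ℝ) : ℝ :=
  (∫ x in OmA ωa, tApp Aa (fun k l => Ea k l x) (fun i j => Fa i j x))
    + q * ∫ x in OmB ωb, tApp Ab (fun k l => Eb k l x) (fun i j => Fb i j x)

/-- the source terms of the (rescaled or limit) problem. -/
def RHS (ωa ωb : Set R2)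
    (fa fb : Fin 3 → R3 → ℝ) (ga gb : Fin 3 → Fin 3 → R3 → ℝ)
    (ha : Fin 3 → R3 → ℝ) (hbp hbm : Fin 3 → R2 → ℝ)
    (ua ub : Fin 3 → R3 → ℝ) (Ea Eb : Fin 3 → Fin 3 → R3 → ℝ) : ℝ :=
  (∫ x in OmA ωa, ∑ k, fa k x * ua k x) + (∫ x in OmB ωb, ∑ k, fb k x * ub k x)
    + (∫ x in OmA ωa, frob (fun i j => ga i j x) (fun i j => Ea i j x))
    + (∫ x in OmB ωb, frob (fun i j => gb i j x) (fun i j => Eb i j x))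
    + (∫ x, (∑ k, ha k x * ua k x) ∂(sigA ωa))
    + (∫ y in ωb, ∑ k, (hbp k y * ub k (y, 0) + hbm k y * ub k (y, -1)))

/-- `(ua, ub)` (with rescaled strains `(Ea, Eb)`) solves the rescaled problem. -/
def SolvesEps (ωa ωb : Set R2) (Aa Ab : Fin 3 → Fin 3 → Fin 3 → Fin 3 → ℝ)
    (ep r q : ℝ)
    (fa fb : Fin 3 → R3 → ℝ) (ga gb : Fin 3 → Fin 3 → R3 → ℝ)
    (ha : Fin 3 → R3 → ℝ) (hbp hbm : Fin 3 → R2 → ℝ)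
    (ua ub : Fin 3 → R3 → ℝ) (Ea Eb : Fin 3 → Fin 3 → R3 → ℝ) : Prop :=
  MemY ωa ωb ep r ua ub ∧
  IsScaledStrain (OmA ωa) (sA r) ua Ea ∧ IsScaledStrain (OmB ωb) (sB ep) ub Eb ∧
  (∀ i j, MemL2 (volume.restrict (OmA ωa)) (Ea i j)) ∧
  (∀ i j, MemL2 (volume.restrict (OmB ωb)) (Eb i j)) ∧
  ∀ va vb Fa Fb, MemY ωa ωb ep r va vb →
    IsScaledStrain (OmA ωa) (sA r) va Fa → IsScaledStrain (OmB ωb) (sB ep) vb Fb →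
    LHS ωa ωb Aa Ab q Ea Eb Fa Fb = RHS ωa ωb fa fb ga gb ha hbp hbm va vb Fa Fb

/-- `z̄ = (z̄ᵃ, z̄ᵇ)` (with limit strains `(EA, EB)`) solves the coupled limit problem in `𝒵`. -/
def SolvesLim (ωa ωb : Set R2) (Aa Ab : Fin 3 → Fin 3 → Fin 3 → Fin 3 → ℝ) (q : ℝ)
    (fa fb : Fin 3 → R3 → ℝ) (ga gb : Fin 3 → Fin 3 → R3 → ℝ)
    (ha : Fin 3 → R3 → ℝ) (hbp hbm : Fin 3 → R2 → ℝ)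
    (uA vA wA uB vB wB : Fin 3 → R3 → ℝ) (EA EB : Fin 3 → Fin 3 → R3 → ℝ) : Prop :=
  MemZa ωa uA vA wA ∧ MemZb ωb uB vB wB ∧ JunctionZ ωa uA uB ∧
  IsLimStrainA (OmA ωa) uA vA wA EA ∧ IsLimStrainB (OmB ωb) uB vB wB EB ∧
  (∀ i j, MemL2 (volume.restrict (OmA ωa)) (EA i j)) ∧
  (∀ i j, MemL2 (volume.restrict (OmB ωb)) (EB i j)) ∧
  ∀ uA' vA' wA' uB' vB' wB' FA FB,
    MemZa ωa uA' vA' wA' → MemZb ωb uB' vB' wB' → JunctionZ ωa uA' uB' →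
    IsLimStrainA (OmA ωa) uA' vA' wA' FA → IsLimStrainB (OmB ωb) uB' vB' wB' FB →
    LHS ωa ωb Aa Ab q EA EB FA FB = RHS ωa ωb fa fb ga gb ha hbp hbm uA' uB' FA FB

/-- componentwise a.e. equality of vector fields on `Ω`. -/
def AEeqV (Ω : Set R3) (u u' : Fin 3 → R3 → ℝ) : Prop :=
  ∀ k, u k =ᵐ[volume.restrict Ω] u' k

/-- componentwise a.e. equality of matrix fields on `Ω`. -/
def AEeqM (Ω : Set R3) (E E' : Fin 3 → Fin 3 → R3 → ℝ) : Prop :=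
  ∀ i j, E i j =ᵐ[volume.restrict Ω] E' i j


/-- the Euclidean ball of radius `r` centered at the origin of `R2`. -/
def ball2 (r : ℝ) : Set R2 := {y : R2 | y.1 ^ 2 + y.2 ^ 2 < r ^ 2}

/-- product description of test functions on the plate. -/
def TF (U : Set R2) (γ : R3 → ℝ) : Prop :=
  ContDiff ℝ (⊤ : ℕ∞) γ ∧ ∃ K : Set R2, IsCompact K ∧ K ⊆ U ∧ ∃ c d : ℝ, -1 < c ∧ d < 0 ∧
    ∀ x : R3, γ x ≠ 0 → x.1 ∈ K ∧ x.2 ∈ Icc c d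

lemma TF.isTest {U : Set R2} {γ : R3 → ℝ} (h : TF U γ) : IsTest3 (OmB U) γ := by
  obtain ⟨h1, K, hK, hKU, c, d, hc, hd, hs⟩ := h
  have hsub : tsupport γ ⊆ K ×ˢ Icc c d := by
    apply closure_minimal
    · intro x hx
      exact hs x hx
    · exact (hK.prod isCompact_Icc).isClosed
  refine ⟨h1, ?_, ?_⟩
  · exact (hK.prod isCompact_Icc).of_isClosed_subset (isClosed_tsupport _) hsub
  · refine hsub.trans (Set.prod_mono hKU ?_)
    intro t ht
    exact ⟨by linarith [ht.1], by linarith [ht.2]⟩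

lemma IsTest3.tf {U : Set R2} {γ : R3 → ℝ} (h : IsTest3 (OmB U) γ) : TF U γ := by
  obtain ⟨h1, h2, h3⟩ := h
  have h2' : IsCompact (tsupport γ) := h2
  refine ⟨h1, Prod.fst '' tsupport γ, h2'.image continuous_fst, ?_, ?_⟩
  · rintro _ ⟨x, hx, rfl⟩
    exact (h3 hx).1
  · rcases (tsupport γ).eq_empty_or_nonempty with he | hne
    · refine ⟨-1/2, -1/2, by norm_num, by norm_num, fun x hx => ?_⟩
      have : x ∈ tsupport γ := subset_tsupport _ hx
      simp [he] at this
    · obtain ⟨x1, hx1, hm1⟩ := h2'.exists_isMinOn hne continuous_snd.continuousOn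
      obtain ⟨x2, hx2, hm2⟩ := h2'.exists_isMaxOn hne continuous_snd.continuousOn
      refine ⟨x1.2, x2.2, (h3 hx1).2.1, (h3 hx2).2.2, fun x hx => ?_⟩
      have hx' : x ∈ tsupport γ := subset_tsupport _ hx
      exact ⟨⟨x, hx', rfl⟩, hm1 hx', hm2 hx'⟩

/-- vertical primitive. -/
def TT (γ : R3 → ℝ) (x : R3) : ℝ := ∫ s in Iic x.2, γ (x.1, s)

lemma TF.slice_int {U : Set R2} {γ : R3 → ℝ} (h : TF U γ) (y : R2) :
    Integrable (fun s => γ (y, s)) := by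
  obtain ⟨h1, K, hK, hKU, c, d, hc, hd, hs⟩ := h
  apply Continuous.integrable_of_hasCompactSupport
  · exact h1.continuous.comp (by fun_prop)
  · apply HasCompactSupport.intro (isCompact_Icc (a := c) (b := d))
    intro s hns
    by_contra hne
    exact hns (hs _ hne).2

lemma TT_contDiff {U : Set R2} {γ : R3 → ℝ} (h : TF U γ) : ContDiff ℝ (⊤ : ℕ∞) (TT γ) := by
  obtain ⟨h1, K, hK, hKU, c, d, hc, hd, hs⟩ := h
  have hf : LocallyIntegrable (indicator (Ici (0:ℝ)) (fun _ => (1:ℝ))) volume :=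
    (locallyIntegrable_const (1:ℝ)).indicator measurableSet_Ici
  have key := contDiffOn_convolution_right_with_param (n := (⊤ : ℕ∞)) (ContinuousLinearMap.mul ℝ ℝ)
    (s := (univ : Set R2)) (g := fun (y : R2) (s : ℝ) => γ (y, s)) (k := Icc c d)
    isOpen_univ isCompact_Icc
    (fun p x _ hx => by
      by_contra hne
      exact hx (hs _ hne).2) hf
    (by
      apply ContDiff.contDiffOn
      exact h1)
  rw [univ_prod_univ, contDiffOn_univ] at key
  convert key using 1
  funext q
  rw [convolution_eq_swap]
  unfold TT
  rw [← integral_indicator measurableSet_Iic]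
  congr 1
  funext s
  by_cases hsq : s ≤ q.2
  · simp [indicator, hsq]
  · simp [indicator, hsq]

lemma pd2_of_hasDerivAt {F : R3 → ℝ} {x : R3} {m : ℝ} (hF : DifferentiableAt ℝ F x)
    (h : HasDerivAt (fun t => F (x.1, t)) m x.2) : pd 2 F x = m := by
  have h2 : HasDerivAt (fun t : ℝ => ((x.1, t) : R3)) ((0, 0), 1) x.2 := by
    have := (hasDerivAt_const x.2 x.1).prodMk (hasDerivAt_id x.2)
    exact this
  have h3 : HasFDerivAt F (fderiv ℝ F x) ((x.1, x.2) : R3) := hF.hasFDerivAt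
  have h4 := h3.comp_hasDerivAt x.2 h2
  have h5 := h4.unique h
  unfold pd b3
  simpa using h5

lemma TT_hasDerivAt {U : Set R2} {γ : R3 → ℝ} (h : TF U γ) (y : R2) (t : ℝ) :
    HasDerivAt (fun t => TT γ (y, t)) (γ (y, t)) t := by
  have hc : Continuous (fun s => γ (y, s)) := h.1.continuous.comp (by fun_prop)
  have e : (fun t => TT γ (y, t)) =
      fun t => (∫ s in (-1:ℝ)..t, γ (y, s)) + ∫ s in Iic (-1:ℝ), γ (y, s) := by
    funext t
    unfold TT
    rw [← intervalIntegral.integral_Iic_sub_Iic (h.slice_int y).integrableOn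
      (h.slice_int y).integrableOn]
    simp
  rw [e]
  apply HasDerivAt.add_const
  exact intervalIntegral.integral_hasDerivAt_right (hc.intervalIntegrable _ _)
    (hc.stronglyMeasurableAtFilter _ _) hc.continuousAt

lemma pd_TT {U : Set R2} {γ : R3 → ℝ} (h : TF U γ) (x : R3) : pd 2 (TT γ) x = γ x :=
  pd2_of_hasDerivAt ((TT_contDiff h).differentiable (by simp) x) (TT_hasDerivAt h x.1 x.2)

lemma TT_zero_of_le {γ : R3 → ℝ} {c d : ℝ} {K : Set R2}
    (hs : ∀ x : R3, γ x ≠ 0 → x.1 ∈ K ∧ x.2 ∈ Icc c d) (y : R2) (t : ℝ) (ht : t < c) :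
    TT γ (y, t) = 0 := by
  unfold TT
  apply setIntegral_eq_zero_of_forall_eq_zero
  intro s hs'
  by_contra hne
  have := (hs _ hne).2.1
  have h2 : s ≤ t := hs'
  simp at this
  linarith

lemma TT_zero_of_notMem {γ : R3 → ℝ} {c d : ℝ} {K : Set R2}
    (hs : ∀ x : R3, γ x ≠ 0 → x.1 ∈ K ∧ x.2 ∈ Icc c d) (y : R2) (t : ℝ) (hy : y ∉ K) :
    TT γ (y, t) = 0 := by
  unfold TT
  apply setIntegral_eq_zero_of_forall_eq_zero
  intro s hs'
  by_contra hne
  exact hy (hs _ hne).1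

lemma TT_top {γ : R3 → ℝ} {c d : ℝ} {K : Set R2}
    (hs : ∀ x : R3, γ x ≠ 0 → x.1 ∈ K ∧ x.2 ∈ Icc c d) (y : R2) (t : ℝ) (ht : d < t) :
    TT γ (y, t) = ∫ s, γ (y, s) := by
  unfold TT
  apply setIntegral_eq_integral_of_forall_compl_eq_zero
  intro s hs'
  by_contra hne
  have := (hs _ hne).2.2
  have h2 : t < s := by simpa using hs'
  simp at this
  linarith

lemma TF.integral_eq {U : Set R2} {γ : R3 → ℝ} (h : TF U γ) (y : R2) :
    TT γ (y, 0) = ∫ s in Ioo (-1:ℝ) 0, γ (y, s) := by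
  obtain ⟨h1, K, hK, hKU, c, d, hc, hd, hs⟩ := h
  rw [TT_top hs y 0 hd]
  symm
  apply setIntegral_eq_integral_of_forall_compl_eq_zero
  intro s hs'
  by_contra hne
  have := (hs _ hne).2
  apply hs'
  simp at this
  exact ⟨by linarith, by linarith⟩

/-- smooth step. -/
def HH (t : ℝ) : ℝ := Real.smoothTransition (3 * t + 2)

lemma HH_contDiff : ContDiff ℝ (⊤ : ℕ∞) HH := by
  unfold HH
  exact Real.smoothTransition.contDiff.comp (by fun_prop)

lemma HH_zero {t : ℝ} (ht : t ≤ -2/3) : HH t = 0 :=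
  Real.smoothTransition.zero_of_nonpos (by linarith)

lemma HH_one {t : ℝ} (ht : -1/3 ≤ t) : HH t = 1 :=
  Real.smoothTransition.one_of_one_le (by linarith)

/-- corrected primitive. -/
def PP (ψ : R3 → ℝ) (x : R3) : ℝ := TT ψ x - HH x.2 * TT ψ (x.1, 0)

lemma PP_TF {U : Set R2} {ψ : R3 → ℝ} (h : TF U ψ) : TF U (PP ψ) := by
  have hT := TT_contDiff h
  obtain ⟨h1, K, hK, hKU, c, d, hc, hd, hs⟩ := h
  refine ⟨?_, K, hK, hKU, min c (-2/3), max d (-1/3), ?_, ?_, ?_⟩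
  · unfold PP
    exact hT.sub ((HH_contDiff.comp contDiff_snd).mul (hT.comp (by fun_prop)))
  · exact lt_min hc (by norm_num)
  · exact max_lt hd (by norm_num)
  · rintro ⟨y, t⟩ hne
    refine ⟨?_, ?_, ?_⟩
    · by_contra hy
      apply hne
      simp only at hy
      simp [PP, TT_zero_of_notMem hs y _ hy]
    · by_contra hy
      apply hne
      simp only [not_le, lt_min_iff] at hy
      simp [PP, TT_zero_of_le hs y t hy.1, HH_zero hy.2.le]
    · by_contra hy
      apply hne
      simp only [not_le, max_lt_iff] at hy
      simp [PP, TT_top hs y t hy.1, TT_top hs y 0 hd, HH_one hy.2.le]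

lemma pd_PP {U : Set R2} {ψ : R3 → ℝ} (h : TF U ψ) (x : R3) :
    pd 2 (PP ψ) x = ψ x - deriv HH x.2 * TT ψ (x.1, 0) := by
  apply pd2_of_hasDerivAt ((PP_TF h).1.differentiable (by simp) x)
  have h1 := TT_hasDerivAt h x.1 x.2
  have h2 : HasDerivAt HH (deriv HH x.2) x.2 :=
    ((HH_contDiff.differentiable (by simp)) x.2).hasDerivAt
  exact h1.sub (h2.mul_const (TT ψ (x.1, 0)))

lemma vol_OmB (U : Set R2) : (volume.restrict (OmB U) : Measure R3) =
    (volume.restrict U).prod (volume.restrict (Ioo (-1:ℝ) 0)) := by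
  rw [Measure.prod_restrict]
  rfl

instance prob_I : IsProbabilityMeasure (volume.restrict (Ioo (-1:ℝ) 0)) :=
  ⟨by simp⟩

lemma dense_test {E : Type*} [NormedAddCommGroup E] [NormedSpace ℝ E] [FiniteDimensional ℝ E]
    [MeasurableSpace E] [BorelSpace E] (μ : Measure E) [IsFiniteMeasureOnCompacts μ]
    {U : Set E} (hU : IsOpen U) {f : E → ℝ} (hf : MemLp f 2 (μ.restrict U))
    {ε : ENNReal} (hε : 0 < ε) :
    ∃ g : E → ℝ, ContDiff ℝ (⊤ : ℕ∞) g ∧ HasCompactSupport g ∧ tsupport g ⊆ U ∧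
      eLpNorm (f - g) 2 (μ.restrict U) < ε := by
  let M : Submodule ℝ (Lp ℝ 2 (μ.restrict U)) :=
    { carrier := {F | ∃ g : E → ℝ, (ContDiff ℝ (⊤ : ℕ∞) g ∧ HasCompactSupport g ∧ tsupport g ⊆ U) ∧
        F =ᵐ[μ.restrict U] g}
      zero_mem' := by
        refine ⟨0, ⟨contDiff_const, HasCompactSupport.zero, ?_⟩, Lp.coeFn_zero _ _ _⟩
        simp [tsupport]
      add_mem' := by
        rintro F G ⟨f1, ⟨h1, h2, h3⟩, h4⟩ ⟨g1, ⟨k1, k2, k3⟩, k4⟩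
        refine ⟨f1 + g1, ⟨h1.add k1, h2.add k2, ?_⟩, (Lp.coeFn_add F G).trans (h4.add k4)⟩
        exact (tsupport_add _ _).trans (union_subset h3 k3)
      smul_mem' := by
        rintro c F ⟨f1, ⟨h1, h2, h3⟩, h4⟩
        refine ⟨c • f1, ⟨h1.const_smul c, h2.smul_left (f := fun _ => c), ?_⟩,
          (Lp.coeFn_smul c F).trans (h4.const_smul c)⟩
        refine (closure_mono ?_).trans h3
        intro x hx
        simp only [Function.mem_support, Pi.smul_apply, smul_eq_mul, ne_eq, mul_eq_zero,
          not_or] at hx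
        exact hx.2 }
  have hM : M.topologicalClosure = ⊤ := by
    rw [Submodule.topologicalClosure_eq_top_iff, Submodule.eq_bot_iff]
    intro F hF
    rw [Submodule.mem_orthogonal] at hF
    have hmem := Lp.memLp F
    have hloc : LocallyIntegrableOn (F : E → ℝ) U μ := by
      rw [locallyIntegrableOn_iff hU.isLocallyClosed]
      intro k hk hkc
      have : MemLp F 2 (μ.restrict k) := hmem.mono_measure (Measure.restrict_mono_set _ hk)
      have hfin : IsFiniteMeasure (μ.restrict k) := ⟨by simpa using hkc.measure_lt_top⟩
      exact this.integrable (by norm_num)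
    have := hU.ae_eq_zero_of_integral_contDiff_smul_eq_zero hloc (by
      intro g h1 h2 h3
      have hg : MemLp g 2 (μ.restrict U) := h1.continuous.memLp_of_hasCompactSupport h2
      have := hF hg.toLp ⟨g, ⟨h1, h2, h3⟩, hg.coeFn_toLp⟩
      rw [L2.inner_def] at this
      have e : ∫ x, g x • F x ∂μ = ∫ x in U, g x • F x ∂μ := by
        symm
        apply setIntegral_eq_integral_of_forall_compl_eq_zero
        intro x hx
        have : g x = 0 := image_eq_zero_of_notMem_tsupport (fun h => hx (h3 h))
        simp [this]
      rw [e, ← this]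
      apply integral_congr_ae
      filter_upwards [hg.coeFn_toLp] with x hx
      rw [hx]
      simp [mul_comm])
    rw [← ae_restrict_iff' hU.measurableSet] at this
    exact (Lp.eq_zero_iff_ae_eq_zero).2 this
  have hmem : hf.toLp ∈ closure (M : Set (Lp ℝ 2 (μ.restrict U))) := by
    rw [← Submodule.topologicalClosure_coe, hM]
    trivial
  obtain ⟨G, ⟨g, ⟨h1, h2, h3⟩, hg⟩, hd⟩ := 
    EMetric.mem_closure_iff.1 hmem ε hε
  refine ⟨g, h1, h2, h3, ?_⟩
  rw [Lp.edist_def] at hd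
  refine lt_of_eq_of_lt (eLpNorm_congr_ae ?_) hd
  filter_upwards [hf.coeFn_toLp, hg] with x hx1 hx2
  simp [hx1, hx2]

lemma TF.cont {U : Set R2} {γ : R3 → ℝ} (h : TF U γ) : Continuous γ := h.1.continuous

lemma TF.memLp {U : Set R2} {γ : R3 → ℝ} (h : TF U γ) (V : Set R3) :
    MemLp γ 2 (volume.restrict V) :=
  h.cont.memLp_of_hasCompactSupport h.isTest.2.1

lemma TF.sub {U : Set R2} {γ δ : R3 → ℝ} (h : TF U γ) (k : TF U δ) : TF U (γ - δ) := by
  have h' := h.isTest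
  have k' := k.isTest
  apply IsTest3.tf
  refine ⟨h'.1.sub k'.1, h'.2.1.sub k'.2.1, ?_⟩
  exact (tsupport_sub _ _).trans (union_subset h'.2.2 k'.2.2)

lemma TT_sub {U : Set R2} {γ δ : R3 → ℝ} (h : TF U γ) (k : TF U δ) :
    TT (γ - δ) = TT γ - TT δ := by
  funext x
  exact integral_sub (h.slice_int x.1).integrableOn (k.slice_int x.1).integrableOn

lemma TT_bound {U : Set R2} {γ : R3 → ℝ} (h : TF U γ) :
    eLpNorm (TT γ) 2 (volume.restrict (OmB U)) ≤ eLpNorm γ 2 (volume.restrict (OmB U)) := by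
  have hTc := (TT_contDiff h).continuous
  have hc := h.cont
  have h0 : ∀ x : R3, x.2 ∈ Ioo (-1:ℝ) 0 → ‖TT γ x‖ₑ ^ (2:ℝ) ≤
      ∫⁻ s in Ioo (-1:ℝ) 0, ‖γ (x.1, s)‖ₑ ^ (2:ℝ) := by
    intro x hx
    have e : TT γ x = ∫ s in Ioc (-1) x.2, γ (x.1, s) := by
      unfold TT
      obtain ⟨h1, K, hK, hKU, c, d, hc, hd, hs⟩ := h
      have : Ioc (-1:ℝ) x.2 = Iic x.2 \ Iic (-1) := by
        ext s
        simp [and_comm]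
      rw [this]
      apply setIntegral_eq_of_subset_of_forall_sdiff_eq_zero measurableSet_Iic sdiff_subset
      intro s hs'
      by_contra hne
      have h3 := (hs _ hne).2.1
      simp at h3 hs'
      have := hs'.2 (by linarith)
      linarith
    have h1 : ‖TT γ x‖ₑ ≤ eLpNorm (fun s => γ (x.1, s)) 1 (volume.restrict (Ioo (-1:ℝ) 0)) := by
      rw [e, eLpNorm_one_eq_lintegral_enorm]
      refine (enorm_integral_le_lintegral_enorm _).trans ?_
      apply lintegral_mono_set
      intro s hs
      exact ⟨hs.1, hs.2.trans_lt hx.2⟩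
    have h2 : eLpNorm (fun s => γ (x.1, s)) 1 (volume.restrict (Ioo (-1:ℝ) 0)) ≤
        eLpNorm (fun s => γ (x.1, s)) 2 (volume.restrict (Ioo (-1:ℝ) 0)) := by
      apply eLpNorm_le_eLpNorm_of_exponent_le (by norm_num)
      exact (hc.comp (by fun_prop : Continuous fun s : ℝ => ((x.1, s) : R3))).aestronglyMeasurable
    have h3 := ENNReal.rpow_le_rpow (h1.trans h2) (by norm_num : (0:ℝ) ≤ 2)
    refine h3.trans_eq ?_
    rw [eLpNorm_eq_lintegral_rpow_enorm_toReal (by norm_num) (by norm_num), ← ENNReal.rpow_mul]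
    simp
  rw [eLpNorm_eq_lintegral_rpow_enorm_toReal (by norm_num) (by norm_num),
    eLpNorm_eq_lintegral_rpow_enorm_toReal (by norm_num) (by norm_num)]
  apply ENNReal.rpow_le_rpow _ (by norm_num)
  have m1 : Measurable fun x : R3 => ‖TT γ x‖ₑ ^ (2:ℝ) := by
    exact hTc.measurable.enorm.pow_const _
  have m2 : Measurable fun x : R3 => ‖γ x‖ₑ ^ (2:ℝ) := by
    exact hc.measurable.enorm.pow_const _
  simp only [ENNReal.toReal_ofNat]
  rw [vol_OmB, lintegral_prod _ m1.aemeasurable, lintegral_prod _ m2.aemeasurable]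
  apply lintegral_mono
  intro y
  calc ∫⁻ t in Ioo (-1:ℝ) 0, ‖TT γ (y, t)‖ₑ ^ (2:ℝ)
      ≤ ∫⁻ t in Ioo (-1:ℝ) 0, (∫⁻ s in Ioo (-1:ℝ) 0, ‖γ (y, s)‖ₑ ^ (2:ℝ)) := by
        apply setLIntegral_mono' measurableSet_Ioo
        intro t ht
        exact h0 (y, t) ht
    _ = _ := by simp

lemma pd_cont {φ : R3 → ℝ} (h : ContDiff ℝ 1 φ) (i : Fin 3) : Continuous (pd i φ) := by
  unfold pd
  exact (h.continuous_fderiv (by norm_num)).clm_apply continuous_const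

lemma pd_supp {φ : R3 → ℝ} {i : Fin 3} {x : R3} (h : x ∉ tsupport φ) : pd i φ x = 0 := by
  have : fderiv ℝ φ x = 0 := by
    by_contra hne
    exact h (support_fderiv_subset ℝ hne)
  simp [pd, this]

lemma pd_hcs {φ : R3 → ℝ} (h : HasCompactSupport φ) (i : Fin 3) : HasCompactSupport (pd i φ) :=
  HasCompactSupport.intro h (fun _ hx => pd_supp hx)

lemma TT_wpd {U : Set R2} {γ : R3 → ℝ} (h : TF U γ) : HasWPD (OmB U) (TT γ) 2 γ := by
  intro φ hφ
  have hT := TT_contDiff h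
  have c1 : Continuous (pd 2 φ) := pd_cont (hφ.1.of_le (by simp)) 2
  have e1 : ∫ x in OmB U, TT γ x * pd 2 φ x = ∫ x, TT γ x * pd 2 φ x := by
    apply setIntegral_eq_integral_of_forall_compl_eq_zero
    intro x hx
    rw [pd_supp (fun h => hx (hφ.2.2 h)), mul_zero]
  have e2 : ∫ x in OmB U, γ x * φ x = ∫ x, γ x * φ x := by
    apply setIntegral_eq_integral_of_forall_compl_eq_zero
    intro x hx
    rw [image_eq_zero_of_notMem_tsupport (fun h => hx (hφ.2.2 h)), mul_zero]
  rw [e1, e2]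
  have e3 : ∀ x, fderiv ℝ (TT γ) x (b3 2) = γ x := fun x => pd_TT h x
  have i1 : (volume : Measure R2).IsAddHaarMeasure :=
    Measure.prod.instIsAddHaarMeasure (volume : Measure ℝ) (volume : Measure ℝ)
  have i2 : (volume : Measure R3).IsAddHaarMeasure :=
    Measure.prod.instIsAddHaarMeasure (volume : Measure R2) (volume : Measure ℝ)
  have := integral_mul_fderiv_eq_neg_fderiv_mul_of_integrable (μ := (volume : Measure R3))
    (f := TT γ) (g := φ) (v := b3 2) ?_ ?_ ?_ (fun x _ => hT.differentiable (by simp) x)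
    (fun x _ => hφ.1.differentiable (by simp) x)
  · simpa only [e3, pd] using this
  · simp only [e3]
    exact (h.cont.mul hφ.1.continuous).integrable_of_hasCompactSupport hφ.2.1.mul_left
  · exact (hT.continuous.mul c1).integrable_of_hasCompactSupport (pd_hcs hφ.2.1 2).mul_left
  · exact (hT.continuous.mul hφ.1.continuous).integrable_of_hasCompactSupport hφ.2.1.mul_left

lemma bdd_of_hcs {X : Type*} [TopologicalSpace X] {f : X → ℝ} (hf : Continuous f)
    (h : HasCompactSupport f) : ∃ C, ∀ x, ‖f x‖ ≤ C :=
  hf.bounded_above_of_compact_support h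

lemma HH'_cont : Continuous (deriv HH) := HH_contDiff.continuous_deriv (by simp)

lemma HH'_bdd : ∃ C, ∀ x, ‖deriv HH x‖ ≤ C := by
  apply bdd_of_hcs HH'_cont
  apply HasCompactSupport.intro (isCompact_Icc (a := (-2/3:ℝ)) (b := (-1/3:ℝ)))
  intro t ht
  by_cases h1 : t < -2/3
  · have : HH =ᶠ[𝓝 t] fun _ => 0 := by
      filter_upwards [Iio_mem_nhds h1] with s hs
      exact HH_zero (le_of_lt hs)
    rw [this.deriv_eq]
    simp
  · have h2 : -1/3 < t := by
      by_contra h3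
      exact ht ⟨not_lt.1 h1, not_lt.1 h3⟩
    have : HH =ᶠ[𝓝 t] fun _ => 1 := by
      filter_upwards [Ioi_mem_nhds h2] with s hs
      exact HH_one (le_of_lt hs)
    rw [this.deriv_eq]
    simp

lemma zero_wpd {U : Set R2} (hU : IsOpen U) (hUf : volume U < ⊤) {u : R3 → ℝ}
    (hu : MemLp u 2 (volume.restrict (OmB U)))
    (hw : ∀ φ, IsTest3 (OmB U) φ → ∫ x in OmB U, u x * pd 2 φ x = 0) :
    ∃ a : R2 → ℝ, MemLp a 2 (volume.restrict U) ∧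
      u =ᵐ[volume.restrict (OmB U)] fun x => a x.1 := by
  have fU : IsFiniteMeasure (volume.restrict U) := ⟨by simpa using hUf⟩
  have hOpen : IsOpen (OmB U) := hU.prod isOpen_Ioo
  have fO : IsFiniteMeasure (volume.restrict (OmB U)) := by
    rw [vol_OmB]
    infer_instance
  have hui : Integrable u (volume.restrict (OmB U)) := hu.integrable (by norm_num)
  obtain ⟨C, hC⟩ := HH'_bdd
  have huH : Integrable (fun x => u x * deriv HH x.2) (volume.restrict (OmB U)) :=
    hui.mul_bdd (HH'_cont.comp continuous_snd).aestronglyMeasurable (by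
      filter_upwards with x using hC _)
  set a : R2 → ℝ := fun y => ∫ s in Ioo (-1:ℝ) 0, u (y, s) * deriv HH s with ha
  have hai : Integrable a (volume.restrict U) := by
    rw [vol_OmB] at huH
    exact huH.integral_prod_left
  have haf : Integrable (fun x : R3 => a x.1) (volume.restrict (OmB U)) := by
    rw [vol_OmB]
    exact hai.comp_fst _
  have hae : u =ᵐ[volume.restrict (OmB U)] fun x => a x.1 := by
    have hd : Integrable (fun x => u x - a x.1) (volume.restrict (OmB U)) := hui.sub haf
    have key := hOpen.ae_eq_zero_of_integral_contDiff_smul_eq_zero (μ := volume)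
      (f := fun x => u x - a x.1) (IntegrableOn.locallyIntegrableOn hd) (by
      intro ψ h1 h2 h3
      have hψ : TF U ψ := IsTest3.tf ⟨h1, h2, h3⟩
      obtain ⟨D, hD⟩ := bdd_of_hcs h1.continuous h2
      have hTc : Continuous (fun y : R2 => TT ψ (y, 0)) :=
        (TT_contDiff hψ).continuous.comp (by fun_prop)
      have hTcs : HasCompactSupport (fun y : R2 => TT ψ (y, 0)) := by
        obtain ⟨h1, K, hK, hKU, c, d, hc, hd, hs⟩ := hψ
        exact HasCompactSupport.intro hK (fun y hy => TT_zero_of_notMem hs y 0 hy)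
      obtain ⟨B, hB⟩ := bdd_of_hcs hTc hTcs
      have e : ∫ x, ψ x • (u x - a x.1) = ∫ x in OmB U, ψ x • (u x - a x.1) := by
        symm
        apply setIntegral_eq_integral_of_forall_compl_eq_zero
        intro x hx
        rw [image_eq_zero_of_notMem_tsupport (fun h => hx (h3 h)), zero_smul]
      have i1 : Integrable (fun x => u x * ψ x) (volume.restrict (OmB U)) :=
        hui.mul_bdd h1.continuous.aestronglyMeasurable (by filter_upwards with x using hD _)
      have i2 : Integrable (fun x => a x.1 * ψ x) (volume.restrict (OmB U)) :=
        haf.mul_bdd h1.continuous.aestronglyMeasurable (by filter_upwards with x using hD _)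
      have i3 : Integrable (fun x => u x * deriv HH x.2 * TT ψ (x.1, 0))
          (volume.restrict (OmB U)) :=
        huH.mul_bdd (hTc.comp continuous_fst).aestronglyMeasurable (by
          filter_upwards with x using hB _)
      have e1 : ∫ x in OmB U, u x * ψ x = ∫ x in OmB U, u x * deriv HH x.2 * TT ψ (x.1, 0) := by
        have := hw _ (PP_TF hψ).isTest
        rw [← sub_eq_zero, ← integral_sub i1 i3]
        refine Eq.trans ?_ this
        congr 1
        funext x
        rw [pd_PP hψ]
        ring
      have e2 : ∫ x in OmB U, u x * deriv HH x.2 * TT ψ (x.1, 0) =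
          ∫ y in U, a y * TT ψ (y, 0) := by
        rw [vol_OmB] at i3 ⊢
        rw [integral_prod _ i3]
        congr 1
        funext y
        simp only [ha]
        rw [integral_mul_const]
      have e3 : ∫ x in OmB U, a x.1 * ψ x = ∫ y in U, a y * TT ψ (y, 0) := by
        rw [vol_OmB] at i2 ⊢
        rw [integral_prod _ i2]
        congr 1
        funext y
        rw [hψ.integral_eq]
        simp only
        rw [integral_const_mul]
      rw [e]
      have e4 : ∀ x : R3, ψ x • (u x - a x.1) = u x * ψ x - a x.1 * ψ x := by
        intro x
        simp only [smul_eq_mul]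
        ring
      simp only [e4]
      rw [integral_sub i1 i2, e1, e2, e3, sub_self])
    rw [← ae_restrict_iff' hOpen.measurableSet] at key
    filter_upwards [key] with x hx
    linarith
  refine ⟨a, ?_, hae⟩
  have h2 := (memLp_congr_ae hae).1 hu
  rw [vol_OmB] at h2
  have mp := measurePreserving_fst (μ := volume.restrict U) (ν := volume.restrict (Ioo (-1:ℝ) 0))
  refine ⟨hai.aestronglyMeasurable, ?_⟩
  rw [← eLpNorm_comp_measurePreserving hai.aestronglyMeasurable mp]
  exact h2.2

lemma approx {U : Set R2} (hU : IsOpen U) (hUf : volume U < ⊤) {v g : R3 → ℝ}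
    (hv : MemLp v 2 (volume.restrict (OmB U))) (hg : MemLp g 2 (volume.restrict (OmB U)))
    (hw : HasWPD (OmB U) v 2 g) {ε : ENNReal} (hε : 0 < ε) :
    ∃ w : R3 → ℝ, ContDiff ℝ 1 w ∧ (∃ K : Set R2, IsCompact K ∧ K ⊆ U ∧
      ∀ x : R3, x.1 ∉ K → w x = 0) ∧
      MemLp w 2 (volume.restrict (OmB U)) ∧ MemLp (pd 2 w) 2 (volume.restrict (OmB U)) ∧
      eLpNorm (w - v) 2 (volume.restrict (OmB U)) ≤ ε ∧
      eLpNorm (pd 2 w - g) 2 (volume.restrict (OmB U)) ≤ ε := by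
  have hOpen : IsOpen (OmB U) := hU.prod isOpen_Ioo
  set μ : Measure R3 := volume.restrict (OmB U) with hμ
  have hex : ∀ n : ℕ, ∃ γ : R3 → ℝ, TF U γ ∧ eLpNorm (g - γ) 2 μ < ((n:ENNReal) + 1)⁻¹ := by
    intro n
    obtain ⟨γ, h1, h2, h3, h4⟩ := dense_test volume hOpen hg (ε := ((n:ENNReal) + 1)⁻¹)
      (by simp)
    exact ⟨γ, IsTest3.tf ⟨h1, h2, h3⟩, h4⟩
  choose γ hγ hγe using hex
  have hTm : ∀ {δ : R3 → ℝ}, TF U δ → MemLp (TT δ) 2 μ := fun h =>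
    ⟨(TT_contDiff h).continuous.aestronglyMeasurable,
      (TT_bound h).trans_lt (h.memLp _).2⟩
  let Y : ℕ → Lp ℝ 2 μ := fun n => ((hγ n).memLp (OmB U)).toLp
  let X : ℕ → Lp ℝ 2 μ := fun n => (hTm (hγ n)).toLp
  have hYlim : Tendsto Y atTop (𝓝 hg.toLp) := by
    rw [tendsto_iff_edist_tendsto_0]
    have hz : Tendsto (fun n : ℕ => ((n:ENNReal) + 1)⁻¹) atTop (𝓝 0) := by
      have := (tendsto_add_atTop_iff_nat 1).2 ENNReal.tendsto_inv_nat_nhds_zero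
      simpa using this
    refine tendsto_of_tendsto_of_tendsto_of_le_of_le tendsto_const_nhds hz (fun _ => zero_le) ?_
    intro n
    simp only [Y]
    rw [edist_comm, Lp.edist_toLp_toLp]
    exact (hγe n).le
  have hXY : ∀ n m, dist (X n) (X m) ≤ dist (Y n) (Y m) := by
    intro n m
    have : edist (X n) (X m) ≤ edist (Y n) (Y m) := by
      simp only [X, Y]
      rw [Lp.edist_toLp_toLp, Lp.edist_toLp_toLp, ← TT_sub (hγ n) (hγ m)]
      exact TT_bound ((hγ n).sub (hγ m))
    rw [edist_dist, edist_dist] at this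
    exact (ENNReal.ofReal_le_ofReal_iff dist_nonneg).1 this
  have hXc : CauchySeq X := by
    have hYc := hYlim.cauchySeq
    rw [Metric.cauchySeq_iff] at hYc ⊢
    intro e he
    obtain ⟨N, hN⟩ := hYc e he
    exact ⟨N, fun m hm n hn => (hXY m n).trans_lt (hN m hm n hn)⟩
  obtain ⟨G, hG⟩ := cauchySeq_tendsto_of_complete hXc
  have hGm : MemLp G 2 μ := Lp.memLp G
  -- inner products as integrals
  have inn : ∀ {f h : R3 → ℝ} (hf : MemLp f 2 μ) (hh : MemLp h 2 μ),
      inner ℝ hf.toLp hh.toLp = ∫ x, h x * f x ∂μ := by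
    intro f h hf hh
    rw [L2.inner_def]
    apply integral_congr_ae
    filter_upwards [hf.coeFn_toLp, hh.coeFn_toLp] with x h1 h2
    rw [h1, h2]
    simp
  have hGw : ∀ φ, IsTest3 (OmB U) φ → ∫ x in OmB U, G x * pd 2 φ x = - ∫ x in OmB U, g x * φ x := by
    intro φ hφ
    have m1 : MemLp φ 2 μ := hφ.1.continuous.memLp_of_hasCompactSupport hφ.2.1
    have m2 : MemLp (pd 2 φ) 2 μ :=
      (pd_cont (hφ.1.of_le (by simp)) 2).memLp_of_hasCompactSupport (pd_hcs hφ.2.1 2)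
    have l1 : Tendsto (fun n => inner ℝ m2.toLp (X n)) atTop (𝓝 (inner ℝ m2.toLp G)) :=
      tendsto_const_nhds.inner hG
    have l2 : Tendsto (fun n => - inner ℝ m1.toLp (Y n)) atTop
        (𝓝 (- inner ℝ m1.toLp hg.toLp)) :=
      (tendsto_const_nhds.inner hYlim).neg
    have e : (fun n => inner ℝ m2.toLp (X n)) = fun n => - inner ℝ m1.toLp (Y n) := by
      funext n
      simp only [X, Y]
      rw [inn, inn]
      exact TT_wpd (hγ n) φ hφ
    rw [e] at l1
    have := tendsto_nhds_unique l1 l2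
    rw [inn m1 hg] at this
    have hGe : G = hGm.toLp := (Lp.toLp_coeFn G hGm).symm
    rw [hGe, inn m2 hGm] at this
    exact this
  obtain ⟨a, ham, hae⟩ := zero_wpd hU hUf (u := v - G) (hv.sub hGm) (by
    intro φ hφ
    have m2 : MemLp (pd 2 φ) 2 μ :=
      (pd_cont (hφ.1.of_le (by simp)) 2).memLp_of_hasCompactSupport (pd_hcs hφ.2.1 2)
    have i1 : Integrable (fun x => v x * pd 2 φ x) μ := hv.integrable_mul m2
    have i2 : Integrable (fun x => G x * pd 2 φ x) μ := hGm.integrable_mul m2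
    have : ∀ x, (v - G) x * pd 2 φ x = v x * pd 2 φ x - G x * pd 2 φ x := by
      intro x
      simp only [Pi.sub_apply]
      ring
    simp only [this]
    rw [integral_sub i1 i2, hGw φ hφ]
    have := hw φ hφ
    rw [this, sub_self])
  have hε2 : 0 < ε / 2 := ENNReal.half_pos hε.ne'
  obtain ⟨b, hb1, hb2, hb3, hb4⟩ := dense_test volume hU ham hε2
  have ev1 : ∀ᶠ n in atTop, edist (X n) G < ε / 2 :=
    (tendsto_iff_edist_tendsto_0.1 hG).eventually (gt_mem_nhds hε2)
  have ev2 : ∀ᶠ n in atTop, edist (Y n) hg.toLp < ε :=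
    (tendsto_iff_edist_tendsto_0.1 hYlim).eventually (gt_mem_nhds hε)
  obtain ⟨n, hn1, hn2⟩ := (ev1.and ev2).exists
  have mp := measurePreserving_fst (μ := volume.restrict U) (ν := volume.restrict (Ioo (-1:ℝ) 0))
  rw [← vol_OmB] at mp
  have hbm : MemLp b 2 (volume.restrict U) := hb1.continuous.memLp_of_hasCompactSupport hb2
  have hbm3 : MemLp (b ∘ Prod.fst) 2 μ := hbm.comp_measurePreserving mp
  have hpd : pd 2 (b ∘ Prod.fst + TT (γ n)) = γ n := by
    funext x
    apply pd2_of_hasDerivAt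
    · exact ((hb1.differentiable (by simp)).comp differentiable_fst).add
        ((TT_contDiff (hγ n)).differentiable (by simp)) x
    · exact (TT_hasDerivAt (hγ n) x.1 x.2).const_add (b x.1)
  refine ⟨b ∘ Prod.fst + TT (γ n), ?_, ?_, hbm3.add (hTm (hγ n)), ?_, ?_, ?_⟩
  · exact ((hb1.comp contDiff_fst).add (TT_contDiff (hγ n))).of_le (by simp)
  · obtain ⟨h1, K, hK, hKU, c, d, hc, hd, hs⟩ := hγ n
    refine ⟨K ∪ tsupport b, hK.union hb2, union_subset hKU hb3, ?_⟩
    intro x hx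
    simp only [mem_union, not_or] at hx
    have t1 := TT_zero_of_notMem hs x.1 x.2 hx.1
    have t2 := image_eq_zero_of_notMem_tsupport hx.2
    simp only [Pi.add_apply, Function.comp, t2, zero_add]
    exact t1
  · rw [hpd]
    exact (hγ n).memLp _
  · have hbae : AEStronglyMeasurable (a - b) (volume.restrict U) := (ham.sub hbm).1
    have n1 : eLpNorm (fun x : R3 => a x.1 - b x.1) 2 μ < ε / 2 := by
      have := eLpNorm_comp_measurePreserving (p := 2) hbae mp
      rw [← this] at hb4
      exact hb4
    have n2 : eLpNorm (TT (γ n) - (G : R3 → ℝ)) 2 μ < ε / 2 := by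
      have hGe : G = hGm.toLp := (Lp.toLp_coeFn G hGm).symm
      rw [hGe] at hn1
      simp only [X] at hn1
      rwa [Lp.edist_toLp_toLp] at hn1
    have n3 : eLpNorm (b ∘ Prod.fst + TT (γ n) - v) 2 μ =
        eLpNorm ((TT (γ n) - (G : R3 → ℝ)) - (fun x : R3 => a x.1 - b x.1)) 2 μ := by
      apply eLpNorm_congr_ae
      filter_upwards [hae] with x hx
      simp only [Pi.sub_apply, Pi.add_apply, Function.comp] at hx ⊢
      linarith
    rw [n3]
    refine (eLpNorm_sub_le ((hTm (hγ n)).sub hGm).1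
      (hbae.comp_measurePreserving mp) (by norm_num)).trans ?_
    refine (add_le_add n2.le n1.le).trans_eq ?_
    exact ENNReal.add_halves ε
  · rw [hpd]
    simp only [Y] at hn2
    rw [Lp.edist_toLp_toLp] at hn2
    exact hn2.le

lemma strong_of {μ : Measure R3} {F : ℕ → R3 → ℝ} {f : R3 → ℝ}
    (hm : ∀ n, MemLp (F n - f) 2 μ)
    (h : Tendsto (fun n => eLpNorm (F n - f) 2 μ) atTop (𝓝 0)) : StrongL2 μ F f := by
  unfold StrongL2
  have e : ∀ n, ∫ x, (F n x - f x) ^ 2 ∂μ = (eLpNorm (F n - f) 2 μ).toReal ^ 2 := by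
    intro n
    rw [(hm n).eLpNorm_eq_integral_rpow_norm (by norm_num) (by norm_num)]
    rw [ENNReal.toReal_ofReal (by positivity), ← Real.rpow_natCast, ← Real.rpow_mul (by positivity)]
    simp
  simp only [e]
  have := ((ENNReal.tendsto_toReal ENNReal.zero_ne_top).comp h).pow 2
  simpa using this

lemma choose_c {μ : Measure R3} [IsFiniteMeasure μ] (h : ℕ → R3 → ℝ)
    (hc : ∀ n, Measurable (h n)) :
    ∃ c : ℝ, ∀ n m, n ≠ m →
      ∀ᵐ x ∂μ, h n x + c / ((n:ℝ) + 1) ≠ h m x + c / ((m:ℝ) + 1) := by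
  let B : ℕ → ℕ → Set ℝ := fun n m => {t | 0 < μ {x | h m x - h n x = t}}
  have hB : ∀ n m, (B n m).Countable := fun n m =>
    Measure.countable_meas_level_set_pos (μ := μ) ((hc m).sub (hc n))
  let k : ℕ → ℕ → ℝ := fun n m => 1 / ((n:ℝ) + 1) - 1 / ((m:ℝ) + 1)
  have hk : ∀ n m, n ≠ m → k n m ≠ 0 := by
    intro n m hnm h0
    apply hnm
    simp only [k, sub_eq_zero, one_div, inv_inj, add_left_inj, Nat.cast_inj] at h0
    exact h0
  let Bad : Set ℝ := ⋃ (n : ℕ) (m : ℕ) (_ : n ≠ m), (fun c : ℝ => c * k n m) ⁻¹' (B n m)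
  have hBad : Bad.Countable := by
    refine countable_iUnion fun n => countable_iUnion fun m => countable_iUnion fun hnm => ?_
    exact (hB n m).preimage_of_injOn
      ((mul_left_injective₀ (hk n m hnm)).injOn)
  obtain ⟨c, hcB⟩ := (hBad.dense_compl ℝ).nonempty
  refine ⟨c, fun n m hnm => ?_⟩
  have h1 : c * k n m ∉ B n m := by
    intro hmem
    apply hcB
    simp only [Bad, mem_iUnion]
    exact ⟨n, m, hnm, hmem⟩
  have h2 : μ {x | h m x - h n x = c * k n m} = 0 := by
    simpa [B] using h1
  rw [ae_iff]
  refine measure_mono_null ?_ h2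
  intro x hx
  simp only [ne_eq, not_not, mem_ofPred_eq] at hx ⊢
  simp only [k]
  have : c * (1 / ((n:ℝ) + 1) - 1 / ((m:ℝ) + 1)) = c / ((n:ℝ) + 1) - c / ((m:ℝ) + 1) := by ring
  rw [this]
  linarith

/-- the square distance to two a.e. different measurable functions determines measurability. -/
lemma aem_of_sq {μ : Measure R3} {p q g : R3 → ℝ} (hp : Measurable p) (hq : Measurable q)
    (hne : ∀ᵐ x ∂μ, p x ≠ q x)
    (h1 : AEMeasurable (fun x => (p x - g x) ^ 2) μ)
    (h2 : AEMeasurable (fun x => (q x - g x) ^ 2) μ) : AEMeasurable g μ := by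
  have h3 : AEMeasurable (fun x => (p x + q x -
      ((p x - g x) ^ 2 - (q x - g x) ^ 2) / (p x - q x)) / 2) μ :=
    (((hp.add hq).aemeasurable.sub ((h1.sub h2).div (hp.sub hq).aemeasurable))).div_const 2
  refine h3.congr ?_
  filter_upwards [hne] with x hx
  have : p x - q x ≠ 0 := sub_ne_zero.2 hx
  field_simp
  ring

/-- Lemma 7: `C¹` functions vanishing on a shrinking disc of the top
face are dense in `L²(ωᵇ;H¹(−1,0))`. -/
theorem density_C1_vanishing_on_junction
    (ωb : Set R2) (hωbO : IsOpen ωb) (hωbB : Bornology.IsBounded ωb)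
    (h0b : ((0:ℝ), (0:ℝ)) ∈ ωb)
    (v : R3 → ℝ) (hv : MemL2H1v (OmB ωb) v) :
    ∃ r : ℕ → ℝ, (∀ n, 0 < r n) ∧ Tendsto r atTop (𝓝 0) ∧
    ∃ vn : ℕ → R3 → ℝ,
      (∀ n, ContDiff ℝ 1 (vn n)) ∧
      (∀ n, ∀ y ∈ ball2 (r n), vn n (y, 0) = 0) ∧
      StrongL2 (volume.restrict (OmB ωb)) vn v ∧
      (∀ g : R3 → ℝ, HasWPD (OmB ωb) v 2 g →
        StrongL2 (volume.restrict (OmB ωb)) (fun n x => pd 2 (vn n) x) g) := by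
  obtain ⟨hv2, g0, hg0, hw0⟩ := hv
  unfold MemL2 at hv2 hg0
  set U : Set R2 := ωb \ {((0:ℝ), (0:ℝ))} with hUdef
  have hU : IsOpen U := hωbO.sdiff isClosed_singleton
  have hfin : volume ωb < ⊤ := hωbB.measure_lt_top
  have hUf : volume U < ⊤ := (measure_mono sdiff_subset).trans_lt hfin
  have hμ : (volume.restrict (OmB ωb) : Measure R3) = volume.restrict (OmB U) := by
    rw [vol_OmB, vol_OmB]
    congr 1
    apply Measure.restrict_congr_set
    exact (sdiff_null_ae_eq_self (measure_singleton _)).symm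
  have hsub : OmB U ⊆ OmB ωb := prod_mono sdiff_subset subset_rfl
  have hwU : HasWPD (OmB U) v 2 g0 := by
    intro φ hφ
    have := hw0 φ ⟨hφ.1, hφ.2.1, hφ.2.2.trans hsub⟩
    rwa [hμ] at this
  have fωb : IsFiniteMeasure (volume.restrict ωb) := ⟨by simpa using hfin⟩
  have fO : IsFiniteMeasure (volume.restrict (OmB ωb)) := by
    rw [vol_OmB]
    infer_instance
  have hex : ∀ n : ℕ, _ := fun n : ℕ => approx hU hUf (hμ ▸ hv2) (hμ ▸ hg0) hwU
    (ε := ((n:ENNReal) + 1)⁻¹) (by simp)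
  rw [← hμ] at hex
  set μ : Measure R3 := volume.restrict (OmB ωb) with hμdef
  choose w hwc hK hwm hpm hwe hpe using hex
  choose K hKc hKU hKz using hK
  -- radii
  have hrad : ∀ n, ∃ ρ : ℝ, 0 < ρ ∧ ∀ y ∈ ball2 ρ, y ∉ K n := by
    intro n
    have h0 : ((0:ℝ), (0:ℝ)) ∈ (K n)ᶜ := by
      intro h
      exact (hKU n h).2 rfl
    obtain ⟨ρ, hρ, hb⟩ := Metric.isOpen_iff.1 (hKc n).isClosed.isOpen_compl _ h0
    refine ⟨ρ, hρ, fun y hy => hb ?_⟩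
    have hy' : y.1 ^ 2 + y.2 ^ 2 < ρ ^ 2 := hy
    rw [Metric.mem_ball, Prod.dist_eq, max_lt_iff]
    simp only [Real.dist_eq, sub_zero]
    constructor
    · apply abs_lt_of_sq_lt_sq _ hρ.le
      nlinarith [sq_nonneg y.2]
    · apply abs_lt_of_sq_lt_sq _ hρ.le
      nlinarith [sq_nonneg y.1]
  choose ρ hρ hρK using hrad
  have hpc : ∀ n, Continuous (pd 2 (w n)) := fun n => pd_cont (hwc n) 2
  obtain ⟨c, hc⟩ := choose_c (μ := μ) (fun n => pd 2 (w n)) (fun n => (hpc n).measurable)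
  have hz : Tendsto (fun n : ℕ => ((n:ENNReal) + 1)⁻¹) atTop (𝓝 0) := by
    have := (tendsto_add_atTop_iff_nat 1).2 ENNReal.tendsto_inv_nat_nhds_zero
    simpa using this
  have hcz : Tendsto (fun n : ℕ => c / ((n:ℝ) + 1)) atTop (𝓝 0) := by
    have := (tendsto_one_div_add_atTop_nhds_zero_nat (𝕜 := ℝ)).const_mul c
    simpa [div_eq_mul_inv] using this
  have hsm : ∀ h : R3 → ℝ, MemLp h 2 μ →
      Tendsto (fun n : ℕ => eLpNorm ((c / ((n:ℝ) + 1)) • h) 2 μ) atTop (𝓝 0) := by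
    intro h hh
    simp only [eLpNorm_const_smul]
    have h1 : Tendsto (fun n : ℕ => ‖c / ((n:ℝ) + 1)‖ₑ) atTop (𝓝 0) := by
      have := (continuous_enorm.tendsto (0:ℝ)).comp hcz
      rw [enorm_zero] at this
      exact this
    have := ENNReal.Tendsto.mul_const h1 (b := eLpNorm h 2 μ) (Or.inr hh.2.ne)
    simpa using this
  have hOm : MeasurableSet (OmB ωb) := (hωbO.prod isOpen_Ioo).measurableSet
  have hsnd : MemLp (fun x : R3 => x.2) 2 μ := by
    apply MemLp.of_bound continuous_snd.aestronglyMeasurable 1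
    rw [hμdef, ae_restrict_iff' hOm]
    filter_upwards with x hx
    rw [Real.norm_eq_abs, abs_le]
    exact ⟨hx.2.1.le, by linarith [hx.2.2]⟩
  have hone : MemLp (fun _ : R3 => (1:ℝ)) 2 μ := memLp_const 1
  let vn : ℕ → R3 → ℝ := fun n => w n + (c / ((n:ℝ) + 1)) • (fun x : R3 => x.2)
  have hvc : ∀ n, ContDiff ℝ 1 (vn n) := fun n =>
    (hwc n).add ((contDiff_snd (𝕜 := ℝ) (E := R2) (F := ℝ)).const_smul (c / ((n:ℝ) + 1)))
  have hpd : ∀ n x, pd 2 (vn n) x = pd 2 (w n) x + c / ((n:ℝ) + 1) := by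
    intro n x
    unfold pd
    have d1 : DifferentiableAt ℝ (w n) x := (hwc n).differentiable (by norm_num) x
    have d2 : HasFDerivAt (fun x : R3 => x.2) (ContinuousLinearMap.snd ℝ R2 ℝ) x := hasFDerivAt_snd
    have d3 := (d1.hasFDerivAt.add (d2.const_smul (c / ((n:ℝ) + 1)))).fderiv
    simp only [vn]
    rw [d3]
    simp [b3]
  have hlim : ∀ (F : ℕ → R3 → ℝ) (f h : R3 → ℝ), MemLp f 2 μ → MemLp h 2 μ →
      (∀ n, MemLp (F n) 2 μ) → (∀ n : ℕ, eLpNorm (F n - f) 2 μ ≤ ((n:ENNReal) + 1)⁻¹) →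
      StrongL2 μ (fun n => F n + (c / ((n:ℝ) + 1)) • h) f := by
    intro F f h hf hh hF hFe
    apply strong_of
    · intro n
      exact ((hF n).add (hh.const_smul _)).sub hf
    · have hs := hz.add (hsm h hh)
      rw [add_zero] at hs
      refine tendsto_of_tendsto_of_tendsto_of_le_of_le tendsto_const_nhds hs (fun _ => zero_le) ?_
      intro n
      have e : F n + (c / ((n:ℝ) + 1)) • h - f = (F n - f) + (c / ((n:ℝ) + 1)) • h := by abel
      simp only [e]
      refine (eLpNorm_add_le ((hF n).sub hf).1 (hh.const_smul _).1 (by norm_num)).trans ?_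
      exact add_le_add (hFe n) le_rfl
  refine ⟨fun n => min (ρ n) (1 / ((n:ℝ) + 1)), ?_, ?_, vn, hvc, ?_, ?_, ?_⟩
  · intro n
    exact lt_min (hρ n) (by positivity)
  · refine tendsto_of_tendsto_of_tendsto_of_le_of_le tendsto_const_nhds
      (tendsto_one_div_add_atTop_nhds_zero_nat (𝕜 := ℝ)) ?_ ?_
    · intro n
      exact (lt_min (hρ n) (by positivity)).le
    · intro n
      exact min_le_right _ _
  · intro n y hy
    have hpos : 0 < min (ρ n) (1 / ((n:ℝ) + 1)) := lt_min (hρ n) (by positivity)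
    have hy2 : y ∈ ball2 (ρ n) := by
      have hy' : y.1 ^ 2 + y.2 ^ 2 < (min (ρ n) (1 / ((n:ℝ) + 1))) ^ 2 := hy
      have : (min (ρ n) (1 / ((n:ℝ) + 1))) ^ 2 ≤ ρ n ^ 2 :=
        pow_le_pow_left₀ hpos.le (min_le_left _ _) 2
      exact hy'.trans_le this
    have := hKz n (y, 0) (hρK n y hy2)
    simp [vn, this]
  · exact hlim w v _ hv2 hsnd hwm hwe
  · intro g hg
    have hstrong : StrongL2 μ (fun n x => pd 2 (vn n) x) g0 := by
      have := hlim (fun n => pd 2 (w n)) g0 _ hg0 hone hpm hpe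
      convert this using 2 with n
      funext x
      rw [hpd]
      simp
    have hpm' : ∀ n, MemLp (fun x => pd 2 (vn n) x) 2 μ := by
      intro n
      have : (fun x => pd 2 (vn n) x) = pd 2 (w n) + fun _ => c / ((n:ℝ) + 1) := by
        funext x
        rw [hpd]
        rfl
      rw [this]
      exact (hpm n).add (memLp_const _)
    have hvm : ∀ n, Measurable (fun x => pd 2 (vn n) x) := fun n => (pd_cont (hvc n) 2).measurable
    by_cases hcase : ∃ n m, n ≠ m ∧ Integrable (fun x => (pd 2 (vn n) x - g x) ^ 2) μ ∧
        Integrable (fun x => (pd 2 (vn m) x - g x) ^ 2) μ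
    · obtain ⟨n, m, hnm, i1, i2⟩ := hcase
      have hgm : AEMeasurable g μ := by
        refine aem_of_sq (hvm n) (hvm m) ?_ i1.aemeasurable i2.aemeasurable
        filter_upwards [hc n m hnm] with x hx
        rw [hpd, hpd]
        exact hx
      have hd : MemLp (fun x => pd 2 (vn n) x - g x) 2 μ :=
        (memLp_two_iff_integrable_sq ((hvm n).aemeasurable.sub hgm).aestronglyMeasurable).2 i1
      have hg2 : MemLp g 2 μ := by
        have := (hpm' n).sub hd
        convert this using 1
        funext x
        simp
      have hae : g =ᵐ[μ] g0 := by
        have hi : Integrable (fun x => g x - g0 x) μ := (hg2.sub hg0).integrable (by norm_num)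
        have key := (hωbO.prod isOpen_Ioo : IsOpen (OmB ωb)).ae_eq_zero_of_integral_contDiff_smul_eq_zero
          (μ := volume) (f := fun x => g x - g0 x) (IntegrableOn.locallyIntegrableOn hi) (by
          intro φ h1 h2 h3
          have e : ∫ x, φ x • (g x - g0 x) = ∫ x in OmB ωb, φ x • (g x - g0 x) := by
            symm
            apply setIntegral_eq_integral_of_forall_compl_eq_zero
            intro x hx
            rw [image_eq_zero_of_notMem_tsupport (fun h => hx (h3 h)), zero_smul]
          have m1 : MemLp φ 2 μ := h1.continuous.memLp_of_hasCompactSupport h2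
          have j1 : Integrable (fun x => g x * φ x) μ := hg2.integrable_mul m1
          have j2 : Integrable (fun x => g0 x * φ x) μ := hg0.integrable_mul m1
          have k1 := hg φ ⟨h1, h2, h3⟩
          have k2 := hw0 φ ⟨h1, h2, h3⟩
          have e4 : ∀ x : R3, φ x • (g x - g0 x) = g x * φ x - g0 x * φ x := by
            intro x
            simp only [smul_eq_mul]
            ring
          rw [e]
          simp only [e4]
          rw [integral_sub j1 j2]
          linarith)
        have key2 : ∀ᵐ x ∂μ, g x - g0 x = 0 := (ae_restrict_iff' hOm).2 key
        filter_upwards [key2] with x hx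
        linarith
      unfold StrongL2 at hstrong ⊢
      refine hstrong.congr fun k => ?_
      apply integral_congr_ae
      filter_upwards [hae] with x hx
      rw [hx]
    · -- at most one index gives an integrable square
      push Not at hcase
      unfold StrongL2
      apply tendsto_const_nhds.congr'
      by_cases hone' : ∃ n, Integrable (fun x => (pd 2 (vn n) x - g x) ^ 2) μ
      · obtain ⟨n, hn⟩ := hone'
        filter_upwards [eventually_gt_atTop n] with m hm
        exact (integral_undef (hcase n m hm.ne hn)).symm
      · push Not at hone'
        filter_upwards with m
        exact (integral_undef (hone' m)).symm

end
end

section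
/- Rescaled interior estimate via the two-dimensional Sobolev embedding: let ω^a and ω^b be bounded open sets in ℝ² with smooth boundary, and let r > 0 satisfy r ω^a ⊂ ω^b. Then there is a constant C, depending only on ω^a and ω^b, such that for every v ∈ H¹_0(ω^b), ∫_{ω^a} |v(r x′)|² dx′ ≤ C r^{−1} ∥v∥²_{H¹_0(ω^b)}. -/
open MeasureTheory Filter Topology Set
open scoped BigOperators MeasureTheory

noncomputable section

/-- Smoothed test function: average of `ψ` along a horizontal segment. -/
def segAvg (T : ℝ) (ψ : R2 → ℝ) (x : R2) : ℝ := ∫ t in Ioc (0:ℝ) T, ψ (x + (t, 0))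

lemma segAvg_contDiff (T : ℝ) (ψ : R2 → ℝ) (h1 : ContDiff ℝ (⊤ : ℕ∞) ψ)
    (h2 : HasCompactSupport ψ) : ContDiff ℝ (⊤ : ℕ∞) (segAvg T ψ) := by
  have hm : Measurable (fun t : ℝ => ((-t, 0) : R2)) := by fun_prop
  let μ : Measure R2 := (volume.restrict (Ioc (0:ℝ) T)).map (fun t => ((-t, 0) : R2))
  have : IsFiniteMeasure μ := Measure.isFiniteMeasure_map _ _
  have hf : LocallyIntegrable (fun _ : R2 => (1:ℝ)) μ := (integrable_const (1:ℝ)).locallyIntegrable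
  have h := h2.contDiff_convolution_right (n := ⊤) (μ := μ) (ContinuousLinearMap.mul ℝ ℝ) hf h1
  convert h using 1
  ext x
  rw [convolution_def]
  simp only [ContinuousLinearMap.mul_apply', one_mul, μ]
  rw [integral_map hm.aemeasurable]
  · simp [segAvg, sub_eq_add_neg]
  · exact (h1.continuous.comp (by fun_prop : Continuous (fun t : R2 => x - t))).aestronglyMeasurable

lemma segAvg_compact (T : ℝ) (ψ : R2 → ℝ) (h2 : HasCompactSupport ψ) :
    HasCompactSupport (segAvg T ψ) := by
  have hK : IsCompact ((fun p : R2 × ℝ => p.1 - (p.2, 0)) '' (tsupport ψ ×ˢ Icc (0:ℝ) T)) :=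
    (h2.isCompact.prod isCompact_Icc).image (by fun_prop)
  refine HasCompactSupport.intro hK ?_
  intro x hx
  unfold segAvg
  apply setIntegral_eq_zero_of_forall_eq_zero
  intro t ht
  by_contra hne
  apply hx
  refine ⟨(x + (t, 0), t), ⟨subset_tsupport _ hne, Ioc_subset_Icc_self ht⟩, ?_⟩
  simp

lemma segAvg_pd (T : ℝ) (hT : 0 < T) (ψ : R2 → ℝ) (h1 : ContDiff ℝ (⊤ : ℕ∞) ψ)
    (h2 : HasCompactSupport ψ) (x : R2) :
    pd2 0 (segAvg T ψ) x = ψ (x + (T, 0)) - ψ x := by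
  have hd : DifferentiableAt ℝ (segAvg T ψ) x :=
    (segAvg_contDiff T ψ h1 h2).differentiable (by simp) x
  have hl : HasDerivAt (fun s : ℝ => x + s • ((1, 0) : R2)) (1, 0) 0 := by
    simpa using ((hasDerivAt_id (0:ℝ)).smul_const ((1, 0) : R2)).const_add x
  have hd' : HasFDerivAt (segAvg T ψ) (fderiv ℝ (segAvg T ψ) x) (x + (0:ℝ) • ((1, 0) : R2)) := by
    simpa using hd.hasFDerivAt
  have e1 := hd'.comp_hasDerivAt 0 hl
  have hc : Continuous (fun τ : ℝ => ψ (x + (τ, 0))) := h1.continuous.comp (by fun_prop)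
  have eq : (segAvg T ψ ∘ fun s : ℝ => x + s • ((1, 0) : R2)) =
      fun s => (∫ τ in (0:ℝ)..(T + s), ψ (x + (τ, 0))) - ∫ τ in (0:ℝ)..s, ψ (x + (τ, 0)) := by
    ext s
    rw [intervalIntegral.integral_interval_sub_left (hc.intervalIntegrable _ _)
      (hc.intervalIntegrable _ _)]
    simp only [Function.comp, segAvg]
    rw [← intervalIntegral.integral_of_le hT.le]
    have := intervalIntegral.integral_comp_add_right (a := 0) (b := T)
      (fun τ : ℝ => ψ (x + (τ, 0))) s
    rw [zero_add] at this
    rw [← this]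
    congr 1
    ext t
    congr 1
    ext <;> simp; ring
  have d1 : HasDerivAt (fun s : ℝ => ∫ τ in (0:ℝ)..s, ψ (x + (τ, 0))) (ψ (x + ((0:ℝ), 0))) 0 :=
    intervalIntegral.integral_hasDerivAt_right (hc.intervalIntegrable _ _)
      (hc.stronglyMeasurableAtFilter _ _) hc.continuousAt
  have d2 : HasDerivAt (fun s : ℝ => ∫ τ in (0:ℝ)..s, ψ (x + (τ, 0))) (ψ (x + (T, 0))) (T + 0) := by
    rw [add_zero]
    exact intervalIntegral.integral_hasDerivAt_right (hc.intervalIntegrable _ _)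
      (hc.stronglyMeasurableAtFilter _ _) hc.continuousAt
  have d3 := (d2.comp_const_add T 0).sub d1
  rw [eq] at e1
  have := e1.unique d3
  unfold pd2 b2
  rw [if_pos rfl, this]
  simp [show ((0:ℝ),(0:ℝ)) = (0 : R2) from rfl]

/-- integrability of the sheared product. -/
lemma shear_int (T : ℝ) (g ψ : R2 → ℝ) (hg : LocallyIntegrable g) (hm : Measurable ψ)
    (c : ℝ) (hc : ∀ x, |ψ x| ≤ c) (h2 : HasCompactSupport ψ) :
    Integrable (fun p : ℝ × R2 => g p.2 * ψ (p.2 + (p.1, 0)))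
      ((volume.restrict (Ioc (0:ℝ) T)).prod volume) := by
  have hK : IsCompact ((fun p : R2 × ℝ => p.1 - (p.2, 0)) '' (tsupport ψ ×ˢ Icc (0:ℝ) T)) :=
    (h2.isCompact.prod isCompact_Icc).image (by fun_prop)
  set K := ((fun p : R2 × ℝ => p.1 - (p.2, 0)) '' (tsupport ψ ×ˢ Icc (0:ℝ) T)) with hKd
  have hgK : Integrable (K.indicator g) :=
    (hg.integrableOn_isCompact hK).integrable_indicator hK.measurableSet
  have h3 : Integrable (fun p : ℝ × R2 => K.indicator g p.2)
      ((volume.restrict (Ioc (0:ℝ) T)).prod volume) := hgK.comp_snd _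
  have h4 := h3.bdd_mul (f := fun p : ℝ × R2 => ψ (p.2 + (p.1, 0))) (c := c)
    (hm.comp (by fun_prop)).aestronglyMeasurable (ae_of_all _ fun p => hc _)
  refine h4.congr ?_
  have : ∀ᵐ p ∂((volume.restrict (Ioc (0:ℝ) T)).prod (volume : Measure R2)), p.1 ∈ Ioc (0:ℝ) T := by
    exact Measure.quasiMeasurePreserving_fst.ae (ae_restrict_mem measurableSet_Ioc)
  filter_upwards [this] with p hp
  by_cases hne : ψ (p.2 + (p.1, 0)) = 0
  · simp [hne]
  · have : p.2 ∈ K := ⟨(p.2 + (p.1, 0), p.1), ⟨subset_tsupport _ hne, Ioc_subset_Icc_self hp⟩, by simp⟩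
    rw [indicator_of_mem this, mul_comm]

lemma shear_mp (T : ℝ) : MeasurePreserving (fun p : ℝ × R2 => (p.1, p.2 - (p.1, 0)))
    ((volume.restrict (Ioc (0:ℝ) T)).prod volume) ((volume.restrict (Ioc (0:ℝ) T)).prod volume) := by
  refine MeasurePreserving.skew_product (f := fun t : ℝ => t)
    (g := fun t (x : R2) => x - (t, 0)) (MeasurePreserving.id _) (by fun_prop) ?_
  exact ae_of_all _ fun t => (measurePreserving_sub_right volume ((t, 0) : R2)).map_eq

lemma shear_int2 (T : ℝ) (g ψ : R2 → ℝ) (hg : LocallyIntegrable g) (hm : Measurable ψ)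
    (c : ℝ) (hc : ∀ x, |ψ x| ≤ c) (h2 : HasCompactSupport ψ) :
    Integrable (fun p : ℝ × R2 => g (p.2 - (p.1, 0)) * ψ p.2)
      ((volume.restrict (Ioc (0:ℝ) T)).prod volume) := by
  have h := (shear_mp T).integrable_comp_of_integrable (shear_int T g ψ hg hm c hc h2)
  refine h.congr (ae_of_all _ fun p => ?_)
  simp [Function.comp]

lemma shear_eq (T : ℝ) (g ψ : R2 → ℝ) (hg : LocallyIntegrable g) (hm : Measurable ψ)
    (c : ℝ) (hc : ∀ x, |ψ x| ≤ c) (h2 : HasCompactSupport ψ) :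
    ∫ x, g x * segAvg T ψ x = ∫ x, ψ x * ∫ t in Ioc (0:ℝ) T, g (x - (t, 0)) := by
  have i1 := shear_int T g ψ hg hm c hc h2
  have i2 := shear_int2 T g ψ hg hm c hc h2
  have e1 := integral_prod_symm _ i1
  have e2 := integral_prod_symm _ i2
  have e3 : ∫ p, g p.2 * ψ (p.2 + (p.1, 0)) ∂((volume.restrict (Ioc (0:ℝ) T)).prod volume) =
      ∫ p, g (p.2 - (p.1, 0)) * ψ p.2 ∂((volume.restrict (Ioc (0:ℝ) T)).prod volume) := by
    have h := (shear_mp T).map_eq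
    conv_lhs => rw [← h]
    rw [integral_map (shear_mp T).aemeasurable (by rw [h]; exact i1.aestronglyMeasurable)]
    simp
  rw [e1, e2] at e3
  simp only [integral_const_mul, integral_mul_const] at e3
  simp only [segAvg]
  rw [e3]
  simp only [mul_comm]

lemma shift_repr (T : ℝ) (hT : 0 < T) (u g : R2 → ℝ) (hu : LocallyIntegrable u)
    (hg : LocallyIntegrable g) (hw : HasWPD2 univ u 0 g) :
    ∀ᵐ x : R2, u x - u (x - (T, 0)) = ∫ t in Ioc (0:ℝ) T, g (x - (t, 0)) := by
  have hus : LocallyIntegrable (fun x : R2 => u (x - (T, 0))) := by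
    intro x
    obtain ⟨s, hs, hi⟩ := hu (x - (T, 0))
    refine ⟨(fun x : R2 => x - (T, 0)) ⁻¹' s, ?_, ?_⟩
    · exact (by fun_prop : Continuous (fun x : R2 => x - (T, 0))).continuousAt.preimage_mem_nhds hs
    · exact ((measurePreserving_sub_right volume ((T, 0) : R2)).integrableOn_comp_preimage
        (MeasurableEquiv.subRight ((T, 0) : R2)).measurableEmbedding).2 hi
  have hgs : LocallyIntegrable (fun x : R2 => ∫ t in Ioc (0:ℝ) T, g (x - (t, 0))) := by
    rw [locallyIntegrable_iff]
    intro K hK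
    have h := shear_int2 T g (K.indicator fun _ => (1:ℝ)) hg
      (measurable_const.indicator hK.measurableSet) 1
      (fun x => by by_cases h : x ∈ K <;> simp [h])
      (HasCompactSupport.intro hK fun x hx => by simp [hx])
    have h' := h.integral_prod_right
    rw [← integrable_indicator_iff hK.measurableSet]
    refine h'.congr (ae_of_all _ fun x => ?_)
    simp only [integral_mul_const]
    by_cases h : x ∈ K <;> simp [h]
  have key := ae_eq_zero_of_integral_contDiff_smul_eq_zero (μ := (volume : Measure R2))
    (f := fun x => (u x - u (x - (T, 0))) - ∫ t in Ioc (0:ℝ) T, g (x - (t, 0)))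
    ((hu.sub hus).sub hgs) ?_
  · filter_upwards [key] with x hx using sub_eq_zero.1 hx
  intro ψ h1 h2
  obtain ⟨c, hc⟩ := h1.continuous.bounded_above_of_compact_support h2
  have i1 : Integrable (fun x => ψ x • u x) := hu.integrable_smul_left_of_hasCompactSupport h1.continuous h2
  have i2 : Integrable (fun x => ψ x • u (x - (T, 0))) :=
    hus.integrable_smul_left_of_hasCompactSupport h1.continuous h2
  have i3 : Integrable (fun x => ψ x • ∫ t in Ioc (0:ℝ) T, g (x - (t, 0))) :=
    hgs.integrable_smul_left_of_hasCompactSupport h1.continuous h2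
  have hW := hw (segAvg T ψ) ⟨segAvg_contDiff T ψ h1 h2, segAvg_compact T ψ h2, subset_univ _⟩
  simp only [setIntegral_univ, segAvg_pd T hT ψ h1 h2] at hW
  rw [shear_eq T g ψ hg h1.continuous.measurable c hc h2] at hW
  have e2 : ∫ x : R2, u x * ψ (x + (T, 0)) = ∫ x : R2, ψ x • u (x - (T, 0)) := by
    rw [← integral_sub_right_eq_self (fun x : R2 => u x * ψ (x + (T, 0))) ((T, 0) : R2)]
    simp [mul_comm]
  have i2' : Integrable (fun x : R2 => u x * ψ (x + (T, 0))) := by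
    have := i2.comp_add_right ((T, 0) : R2)
    simpa [mul_comm] using this
  have e1 : ∫ x : R2, u x * (ψ (x + (T, 0)) - ψ x) =
      (∫ x : R2, ψ x • u (x - (T, 0))) - ∫ x : R2, ψ x • u x := by
    rw [← e2, ← integral_sub i2' i1]
    congr 1; ext x; simp; ring
  rw [e1] at hW
  simp only [smul_sub]
  have i12 : Integrable (fun x => ψ x • u x - ψ x • u (x - (T, 0))) := i1.sub i2
  rw [integral_sub i12 i3, integral_sub i1 i2]
  simp only [smul_eq_mul] at hW ⊢
  linarith

lemma wpd_zero (U : Set R2) (hU : IsOpen U) (u g : R2 → ℝ) (hg : LocallyIntegrable g)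
    (hw : HasWPD2 univ u 0 g) (hz : ∀ x ∈ U, u x = 0) : ∀ᵐ x, x ∈ U → g x = 0 := by
  refine hU.ae_eq_zero_of_integral_contDiff_smul_eq_zero (hg.locallyIntegrableOn U) ?_
  intro ψ h1 h2 h3
  have h := hw ψ ⟨h1, h2, subset_univ _⟩
  simp only [setIntegral_univ] at h
  have : ∫ x, u x * pd2 0 ψ x = 0 := by
    rw [← integral_zero R2 ℝ]
    congr 1
    ext x
    by_cases hx : x ∈ U
    · simp [hz x hx]
    · have : fderiv ℝ ψ x = 0 := by
        by_contra hne
        exact hx (h3 (support_fderiv_subset ℝ hne))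
      simp [pd2, this]
  rw [this] at h
  simp only [smul_eq_mul, mul_comm (ψ _)]
  linarith

lemma cs_int (a b : ℝ) (hab : a < b) (g : ℝ → ℝ) (h1 : IntegrableOn g (Ioc a b))
    (h2 : IntegrableOn (fun s => g s ^ 2) (Ioc a b)) :
    (∫ s in Ioc a b, g s) ^ 2 ≤ (b - a) * ∫ s in Ioc a b, g s ^ 2 := by
  have hL : 0 < b - a := by linarith
  set I := ∫ s in Ioc a b, g s with hI
  set c := I / (b - a) with hcd
  have h0 : 0 ≤ ∫ s in Ioc a b, (g s ^ 2 - 2 * c * g s + c ^ 2) := by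
    refine integral_nonneg fun s => ?_
    have : (0:ℝ) ≤ (g s - c) ^ 2 := sq_nonneg _
    simp only [Pi.zero_apply]
    nlinarith
  have h12 : IntegrableOn (fun s => g s ^ 2 - 2 * c * g s) (Ioc a b) := h2.sub (h1.const_mul _)
  rw [integral_add h12 (integrable_const _), integral_sub h2 (h1.const_mul _),
    integral_const_mul, ← hI] at h0
  simp [max_eq_left hL.le] at h0
  have hc : c * (b - a) = I := by rw [hcd]; field_simp
  have : (b - a) * c ^ 2 = c * I := by rw [← hc]; ring
  have h5 : 0 ≤ (∫ s in Ioc a b, g s ^ 2) - c * I := by linarith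
  have := mul_nonneg hL.le h5
  have h6 : (b - a) * (c * I) = I ^ 2 := by rw [← hc]; ring
  nlinarith

lemma stamp (f g : ℝ → ℝ) (h : ∀ᵐ x : ℝ, HasDerivAt f (g x) x) :
    ∀ᵐ x : ℝ, f x = 0 → g x = 0 := by
  have hz : volume {x | f x = 0 ∧ HasDerivAt f (g x) x ∧ g x ≠ 0} = 0 := by
    apply measure_null_of_locally_null
    rintro x ⟨h1, h2, h3⟩
    refine ⟨{x}, ?_, by simp⟩
    have := h2.eventually_ne (c := 0) h3
    rw [eventually_nhdsWithin_iff] at this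
    rw [mem_nhdsWithin_iff_eventually]
    filter_upwards [this] with z hz hz2
    by_contra hne
    exact hz hne hz2.1
  have hz' : ∀ᵐ x : ℝ, ¬ (f x = 0 ∧ HasDerivAt f (g x) x ∧ g x ≠ 0) := by
    rw [ae_iff]; simpa using hz
  filter_upwards [h, hz'] with x a b c
  by_contra hne
  exact b ⟨c, a, hne⟩

lemma one_dim (M : ℝ) (hM : 0 < M) (u g : ℝ → ℝ) (S : Set ℝ) (hS : MeasurableSet S)
    (hSM : S ⊆ Ioo (-M) M) (hgm : MemLp g 2) (hu : ∀ s, s ∉ S → u s = 0)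
    (hg0 : ∀ᵐ s, s < -M → g s = 0)
    (hrep : ∀ᵐ s, s < M → u s = ∫ t in Ioc (0:ℝ) (2 * M), g (s - t)) :
    ∀ᵐ s, u s ^ 2 ≤ 2 * M * ∫ t in S, g t ^ 2 := by
  have hgl : LocallyIntegrable g := hgm.locallyIntegrable (by norm_num)
  have hsq : Integrable (fun s => g s ^ 2) := hgm.integrable_sq
  have hii : ∀ a b, IntervalIntegrable g volume a b := fun a b =>
    ((hgl.integrableOn_isCompact isCompact_uIcc).intervalIntegrable)
  have hf : ∀ᵐ s, s ∈ Ioo (-M) M → u s = ∫ t in (-M)..s, g t := by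
    filter_upwards [hrep] with s hs hsM
    rw [hs hsM.2, ← intervalIntegral.integral_of_le (by linarith),
      intervalIntegral.integral_comp_sub_left (fun t => g t) s, sub_zero,
      ← intervalIntegral.integral_add_adjacent_intervals (hii (s - 2 * M) (-M)) (hii (-M) s)]
    have : ∫ t in (s - 2 * M)..(-M), g t = 0 := by
      rw [intervalIntegral.integral_of_le (by linarith [hsM.2]), integral_Ioc_eq_integral_Ioo]
      rw [setIntegral_congr_ae (g := fun _ => (0:ℝ)) measurableSet_Ioo]
      · simp
      · filter_upwards [hg0] with t ht ht2 using ht ht2.2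
    rw [this, zero_add]
  have hder : ∀ᵐ s : ℝ, HasDerivAt (fun s => ∫ t in (-M)..s, g t) (g s) s := by
    filter_upwards [LocallyIntegrable.ae_hasDerivAt_integral hgl] with s hs using hs (-M)
  have hst := stamp _ _ hder
  have hgz : ∀ᵐ s, s ∈ Ioo (-M) M → s ∉ S → g s = 0 := by
    filter_upwards [hf, hst] with s h1 h2 h3 h4
    exact h2 (by rw [← h1 h3]; exact hu s h4)
  have hSe : ∫ t in Ioo (-M) M, g t ^ 2 = ∫ t in S, g t ^ 2 := by
    apply setIntegral_eq_of_subset_of_ae_sdiff_eq_zero measurableSet_Ioo.nullMeasurableSet hSM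
    filter_upwards [hgz] with s h1 h2
    simp [h1 h2.1 h2.2]
  rw [← hSe]
  have hn : 0 ≤ ∫ t in Ioo (-M) M, g t ^ 2 := integral_nonneg fun t => sq_nonneg _
  filter_upwards [hf] with s hs
  by_cases h : s ∈ Ioo (-M) M
  · rw [hs h, intervalIntegral.integral_of_le h.1.le]
    refine (cs_int (-M) s h.1 g ((hii _ _).1) hsq.integrableOn).trans ?_
    have : ∫ t in Ioc (-M) s, g t ^ 2 ≤ ∫ t in Ioo (-M) M, g t ^ 2 :=
      setIntegral_mono_set hsq.integrableOn (ae_of_all _ fun t => sq_nonneg _)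
        (LE.le.eventuallyLE fun t ht => ⟨ht.1, ht.2.trans_lt h.2⟩)
    have h0 : 0 ≤ ∫ t in Ioc (-M) s, g t ^ 2 := integral_nonneg fun t => sq_nonneg _
    nlinarith [h.1, h.2]
  · rw [hu s fun h' => h (hSM h')]
    have := mul_nonneg (by linarith : (0:ℝ) ≤ 2 * M) hn
    simpa using this

lemma ae_slices {p : R2 → Prop} (h : ∀ᵐ x : R2, p x) : ∀ᵐ y : ℝ, ∀ᵐ x : ℝ, p (x, y) := by
  have h' : ∀ᵐ z ∂((volume : Measure ℝ).prod (volume : Measure ℝ)), p z.swap :=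
    (Measure.measurePreserving_swap (μ := (volume : Measure ℝ)) (ν := (volume : Measure ℝ))).quasiMeasurePreserving.ae h
  exact Measure.ae_ae_of_ae_prod h'

lemma slice_bound (M : ℝ) (hM : 0 < M) (u g : R2 → ℝ) (ω : Set R2) (hω : MeasurableSet ω)
    (hωM : ∀ x ∈ ω, x.1 ∈ Ioo (-M) M) (hum : MemLp u 2) (hgm : MemLp g 2)
    (hu : ∀ s, s ∉ ω → u s = 0) (hw : HasWPD2 univ u 0 g) :
    ∀ᵐ y : ℝ, ∀ᵐ x : ℝ, u (x, y) ^ 2 ≤ 2 * M * ∫ t in {t : ℝ | (t, y) ∈ ω}, g (t, y) ^ 2 := by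
  have hul : LocallyIntegrable u := hum.locallyIntegrable (by norm_num)
  have hgl : LocallyIntegrable g := hgm.locallyIntegrable (by norm_num)
  have h1 := ae_slices (shift_repr (2 * M) (by linarith) u g hul hgl hw)
  have h2 := ae_slices (wpd_zero {x | x.1 < -M} (isOpen_lt (by fun_prop) (by fun_prop)) u g hgl hw
    (fun x hx => hu x fun hx' => by have := (hωM x hx').1; simp at hx; linarith))
  have h3 : ∀ᵐ y : ℝ, AEStronglyMeasurable (fun x => g (x, y)) :=
    AEStronglyMeasurable.prodMk_left (hgm.1.prod_swap)
  have h4 : ∀ᵐ y : ℝ, Integrable (fun x => g (x, y) ^ 2) :=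
    Integrable.prod_left_ae hgm.integrable_sq
  filter_upwards [h1, h2, h3, h4] with y a1 a2 a3 a4
  refine one_dim M hM (fun x => u (x, y)) (fun x => g (x, y)) {t | (t, y) ∈ ω}
    (hω.preimage (by fun_prop)) (fun t ht => hωM _ ht) ((memLp_two_iff_integrable_sq a3).2 a4)
    (fun s hs => hu _ hs) a2 ?_
  filter_upwards [a1] with s hs hsM
  have : u ((s, y) - (2 * M, 0)) = 0 := hu _ fun h => by
    have := (hωM _ h).1
    simp at this; linarith
  rw [this, sub_zero] at hs
  simpa using hs

/-- rescaled interior estimate via the 2D Sobolev embedding. -/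
theorem rescaled_interior_estimate
    (ωa ωb : Set R2) (hωaO : IsOpen ωa) (hωaB : Bornology.IsBounded ωa)
    (hωbO : IsOpen ωb) (hωbB : Bornology.IsBounded ωb) :
    ∃ C > (0:ℝ), ∀ r : ℝ, 0 < r → rsc r '' ωa ⊆ ωb →
      ∀ (v : R2 → ℝ) (g : Fin 2 → R2 → ℝ),
        MemH10_2 ωb v →
        (∀ i, HasWPD2 univ (zext2 ωb v) i (g i)) →
        (∀ i, MemL2 (volume : Measure R2) (g i)) →
        (∫ y in ωa, (v (rsc r y)) ^ 2)
          ≤ C / r * ∫ y in ωb, ((g 0 y) ^ 2 + (g 1 y) ^ 2) := by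
  obtain ⟨M, hM, hMb⟩ := hωbB.subset_ball_lt 0 0
  obtain ⟨R, hR, hRa⟩ := hωaB.subset_ball_lt 0 0
  have hb1 : ∀ x ∈ ωb, x.1 ∈ Ioo (-M) M := by
    intro x hx
    have h := hMb hx
    rw [mem_ball_zero_iff] at h
    have h' : |x.1| < M := (norm_fst_le x).trans_lt h
    exact abs_lt.1 h'
  have ha1 : ∀ x ∈ ωa, x.1 ∈ Ioo (-R) R := by
    intro x hx
    have h := hRa hx
    rw [mem_ball_zero_iff] at h
    have h' : |x.1| < R := (norm_fst_le x).trans_lt h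
    exact abs_lt.1 h'
  refine ⟨4 * M * R, by positivity, ?_⟩
  intro r hr hsub v g hv hw hg
  set u := zext2 ωb v with hu
  have hum : MemLp u 2 := by
    have := hv.1
    simpa [MemL2] using this
  have hg0 : MemLp (g 0) 2 := hg 0
  have hg1 : MemLp (g 1) 2 := hg 1
  have hsb := slice_bound M hM u (g 0) ωb hωbO.measurableSet hb1 hum hg0
    (fun s hs => by simp [hu, zext2, hs]) (hw 0)
  have hsq0 : Integrable (fun x => g 0 x ^ 2) := hg0.integrable_sq
  have hsq1 : Integrable (fun x => g 1 x ^ 2) := hg1.integrable_sq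
  -- the slice energy
  set G : ℝ → ℝ := fun y => ∫ t in {t : ℝ | (t, y) ∈ ωb}, g 0 (t, y) ^ 2 with hG
  have hGi' : Integrable (ωb.indicator fun x => g 0 x ^ 2) := hsq0.indicator hωbO.measurableSet
  have hGe : G = fun y => ∫ t, (ωb.indicator fun x => g 0 x ^ 2) (t, y) := by
    ext y
    simp only [hG]
    have hms : MeasurableSet {t : ℝ | (t, y) ∈ ωb} :=
      hωbO.measurableSet.preimage (by fun_prop : Measurable fun t : ℝ => (t, y))
    rw [← integral_indicator hms]
    rfl
  have hGi : Integrable G := by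
    rw [hGe]
    exact Integrable.integral_prod_right hGi'
  have hGt : ∫ y, G y = ∫ x in ωb, g 0 x ^ 2 := by
    rw [← integral_indicator hωbO.measurableSet, hGe]
    exact (integral_prod_symm _ hGi').symm
  have hmain : (∫ y in ωa, (v (rsc r y)) ^ 2) ≤ 4 * M * R / r * ∫ x in ωb, g 0 x ^ 2 := by
    have e1 : (∫ y in ωa, (v (rsc r y)) ^ 2) = ∫ y, ωa.indicator (fun y => u (r • y) ^ 2) y := by
      rw [integral_indicator hωaO.measurableSet]
      apply setIntegral_congr_fun hωaO.measurableSet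
      intro y hy
      have : rsc r y ∈ ωb := hsub ⟨y, hy, rfl⟩
      have h2 : u (r • y) = v (rsc r y) := by
        simp only [hu, zext2]
        exact indicator_of_mem this v
      simp [h2]
    have hi : Integrable (ωa.indicator (fun y => u (r • y) ^ 2)) := by
      refine Integrable.indicator ?_ hωaO.measurableSet
      exact hum.integrable_sq.comp_smul hr.ne'
    rw [e1, show (∫ y, ωa.indicator (fun y => u (r • y) ^ 2) y) = _ from integral_prod_symm _ hi]
    have hrhs : Integrable (fun y => 4 * M * R * G (r * y)) :=
      (hGi.comp_mul_left' hr.ne').const_mul _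
    have hq : Measure.QuasiMeasurePreserving (fun x : ℝ => r • x) volume volume :=
      Measure.quasiMeasurePreserving_smul volume hr.ne'
    calc _ ≤ ∫ y, 4 * M * R * G (r * y) := by
          refine integral_mono_of_nonneg (ae_of_all _ fun y => integral_nonneg fun x =>
            indicator_nonneg (fun _ _ => sq_nonneg _) _) hrhs ?_
          filter_upwards [hq.ae hsb] with y hy
          have hy' := hq.ae hy
          have hGn : 0 ≤ G (r * y) := integral_nonneg fun t => sq_nonneg _
          have hint : Integrable ((Ioo (-R) R).indicator fun _ : ℝ => 2 * M * G (r * y)) :=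
            (integrable_indicator_iff measurableSet_Ioo).2 (integrableOn_const (by simp))
          calc _ ≤ ∫ x, (Ioo (-R) R).indicator (fun _ : ℝ => 2 * M * G (r * y)) x := by
                refine integral_mono_of_nonneg (ae_of_all _ fun x =>
                  indicator_nonneg (fun _ _ => sq_nonneg _) _) hint ?_
                filter_upwards [hy'] with x hx
                by_cases h : (x, y) ∈ ωa
                · rw [indicator_of_mem h, indicator_of_mem (ha1 _ h)]
                  exact hx
                · rw [indicator_of_notMem h]
                  exact indicator_nonneg (fun _ _ => by positivity) _
            _ = 4 * M * R * G (r * y) := by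
                rw [integral_indicator measurableSet_Ioo]
                simp
                rw [max_eq_left (by linarith)]
                ring
      _ = 4 * M * R / r * ∫ x in ωb, g 0 x ^ 2 := by
          rw [integral_const_mul, Measure.integral_comp_mul_left, hGt, abs_of_pos (by positivity)]
          simp only [smul_eq_mul]
          ring
  refine hmain.trans ?_
  apply mul_le_mul_of_nonneg_left _ (by positivity)
  exact integral_mono hsq0.integrableOn (hsq0.integrableOn.add hsq1.integrableOn)
    fun x => le_add_of_nonneg_right (sq_nonneg _)

end
end
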